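/- arXiv:2601.11017 — 18 statements merged into one kernel-verified Lean document; each statement's English description precedes it below -/
import Mathlib

section
/- Let (A, ∘_A, [·,·]_A) and (B, ∘_B, [·,·]_B) be dual pre-Poisson algebras over a field F of characteristic 0. Define bilinear operations on the tensor product A ⊗ B by (x⊗a) ∘ (y⊗b) = (x ∘_A y) ⊗ (a ∘_B b) and [x⊗a, y⊗b] = [x,y]_A ⊗ (a ∘_B b) + (x ∘_A y) ⊗ [a,b]_B for all x,y ∈ A, a,b ∈ B. Then (A ⊗ B, ∘, [·,·]) is a dual pre-Poisson algebra. -/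
open scoped TensorProduct

/-- A dual pre-Poisson algebra structure on a vector space over `F`. -/
def IsDualPrePoisson (F : Type*) {A : Type*} [Field F] [AddCommGroup A] [Module F A]
    (mul br : A →ₗ[F] A →ₗ[F] A) : Prop :=
  (∀ x y z : A, mul x (mul y z) = mul (mul x y) z) ∧
  (∀ x y z : A, mul (mul x y) z = mul (mul y x) z) ∧
  (∀ x y z : A, br x (br y z) = br (br x y) z + br y (br x z)) ∧
  (∀ x y z : A, br x (mul y z) = mul (br x y) z + mul y (br x z)) ∧
  (∀ x y z : A, br (mul x y) z = mul x (br y z) + mul y (br x z)) ∧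
  (∀ x y z : A, mul (br x y) z = - mul (br y x) z)

theorem stmt1 {F A B : Type*} [Field F] [CharZero F]
    [AddCommGroup A] [Module F A] [AddCommGroup B] [Module F B]
    (mulA brA : A →ₗ[F] A →ₗ[F] A) (mulB brB : B →ₗ[F] B →ₗ[F] B)
    (hA : IsDualPrePoisson F mulA brA) (hB : IsDualPrePoisson F mulB brB)
    (mul br : (A ⊗[F] B) →ₗ[F] (A ⊗[F] B) →ₗ[F] (A ⊗[F] B))
    (hmul : ∀ (x y : A) (a b : B),
      mul (x ⊗ₜ[F] a) (y ⊗ₜ[F] b) = (mulA x y) ⊗ₜ[F] (mulB a b))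
    (hbr : ∀ (x y : A) (a b : B),
      br (x ⊗ₜ[F] a) (y ⊗ₜ[F] b)
        = (brA x y) ⊗ₜ[F] (mulB a b) + (mulA x y) ⊗ₜ[F] (brB a b)) :
    IsDualPrePoisson F mul br := by
  obtain ⟨A1, A2, A3, A4, A5, A6⟩ := hA
  obtain ⟨B1, B2, B3, B4, B5, B6⟩ := hB
  have ind : ∀ P : A ⊗[F] B → A ⊗[F] B → A ⊗[F] B → Prop,
      (∀ Y Z, P 0 Y Z) → (∀ X Z, P X 0 Z) → (∀ X Y, P X Y 0) →
      (∀ X X' Y Z, P X Y Z → P X' Y Z → P (X + X') Y Z) →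
      (∀ X Y Y' Z, P X Y Z → P X Y' Z → P X (Y + Y') Z) →
      (∀ X Y Z Z', P X Y Z → P X Y Z' → P X Y (Z + Z')) →
      (∀ x a y b z c, P (x ⊗ₜ a) (y ⊗ₜ b) (z ⊗ₜ c)) → ∀ X Y Z, P X Y Z := by
    intro P h1 h2 h3 h4 h5 h6 h X Y Z
    induction X with
    | zero => exact h1 _ _
    | add X X' hX hX' => exact h4 _ _ _ _ hX hX'
    | tmul x a =>
      induction Y with
      | zero => exact h2 _ _
      | add Y Y' hY hY' => exact h5 _ _ _ _ hY hY'
      | tmul y b =>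
        induction Z with
        | zero => exact h3 _ _
        | add Z Z' hZ hZ' => exact h6 _ _ _ _ hZ hZ'
        | tmul z c => exact h x a y b z c
  refine ⟨?_, ?_, ?_, ?_, ?_, ?_⟩ <;> apply ind
  all_goals first
    | (intros; simp only [map_zero, LinearMap.zero_apply, add_zero, neg_zero]; done)
    | (intro X Y Z W h h'
       simp only [map_add, LinearMap.add_apply]; rw [h, h']; abel)
    | (intro X Y Z W h h'
       simp only [map_add, LinearMap.add_apply]; rw [h, h']; done)
    | (intro x a y b z c
       simp only [hmul, hbr, map_add, LinearMap.add_apply, A1, A3 x y z, A4, A5, B1, B3 a b c, B4, B5,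
         A2 y x z, B2 b a c, A6 y x z, B6 b a c,
         TensorProduct.add_tmul, TensorProduct.tmul_add, TensorProduct.neg_tmul,
         TensorProduct.tmul_neg]
       try abel)
end

section
/- Let (A, ∙, {·,·}) be a Poisson algebra over a field F of characteristic 0 and let P: A → A be an average operator on A, i.e. a linear map satisfying P(x) ∙ P(y) = P(P(x) ∙ y) and {P(x), P(y)} = P({P(x), y}) for all x, y ∈ A. Define new bilinear operations on A by x ∘ y := P(x) ∙ y and [x, y] := {P(x), y}. Then (A, ∘, [·,·]) is a dual pre-Poisson algebra. -/
/-- A Poisson algebra structure: commutative associative product `mul`,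
Lie bracket `br` (alternating, Jacobi), with the Leibniz rule. -/
def IsPoisson (F : Type*) {A : Type*} [Field F] [AddCommGroup A] [Module F A]
    (mul br : A →ₗ[F] A →ₗ[F] A) : Prop :=
  (∀ x y : A, mul x y = mul y x) ∧
  (∀ x y z : A, mul (mul x y) z = mul x (mul y z)) ∧
  (∀ x : A, br x x = 0) ∧
  (∀ x y z : A, br (br x y) z + br (br y z) x + br (br z x) y = 0) ∧
  (∀ x y z : A, br x (mul y z) = mul (br x y) z + mul y (br x z))

theorem stmt2 {F A : Type*} [Field F] [CharZero F] [AddCommGroup A] [Module F A]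
    (mul br : A →ₗ[F] A →ₗ[F] A) (h : IsPoisson F mul br)
    (P : A →ₗ[F] A)
    (hP1 : ∀ x y : A, mul (P x) (P y) = P (mul (P x) y))
    (hP2 : ∀ x y : A, br (P x) (P y) = P (br (P x) y))
    (circ brk : A →ₗ[F] A →ₗ[F] A)
    (hcirc : ∀ x y : A, circ x y = mul (P x) y)
    (hbrk : ∀ x y : A, brk x y = br (P x) y) :
    IsDualPrePoisson F circ brk := by
  obtain ⟨hc, ha, h0, hJ, hL⟩ := h
  have hs : ∀ x y : A, br x y = - br y x := by
    intro x y
    have h1 := h0 (x + y)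
    simp only [map_add, LinearMap.add_apply, h0, zero_add, add_zero] at h1
    exact eq_neg_of_add_eq_zero_right h1
  refine ⟨?_, ?_, ?_, ?_, ?_, ?_⟩ <;> intro x y z <;> simp only [hcirc, hbrk, ← hP1, ← hP2]
  · exact (ha _ _ _).symm
  · rw [hc (P x)]
  · have h1 := hJ (P x) (P y) z
    rw [hs (br (P y) z) (P x), hs z (P x), map_neg, LinearMap.neg_apply,
      hs (br (P x) z) (P y), neg_neg] at h1
    rw [← sub_eq_zero, ← neg_eq_zero, ← h1]
    abel
  · exact hL _ _ _
  · rw [hs, hL, hs z (P x), hs z (P y), map_neg, map_neg, LinearMap.neg_apply,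
      hc (br (P x) z)]
    abel
  · rw [hs (P x), map_neg, LinearMap.neg_apply]
end

section
/- Let (A, ⋆) be a permutative algebra and (B, ∙, {·,·}) be a Poisson algebra over a field F of characteristic 0. Define bilinear operations on A ⊗ B by (x⊗a) ∘ (y⊗b) = (x ⋆ y) ⊗ (a ∙ b) and [x⊗a, y⊗b] = (x ⋆ y) ⊗ {a, b} for all x,y ∈ A, a,b ∈ B. Then (A ⊗ B, ∘, [·,·]) is a dual pre-Poisson algebra. -/
open scoped TensorProduct

/-- A permutative algebra structure. -/
def IsPermutative (F : Type*) {A : Type*} [Field F] [AddCommGroup A] [Module F A]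
    (mul : A →ₗ[F] A →ₗ[F] A) : Prop :=
  (∀ x y z : A, mul x (mul y z) = mul (mul x y) z) ∧
  (∀ x y z : A, mul (mul x y) z = mul (mul y x) z)

/-- To prove an identity additive in three tensor variables, check pure tensors. -/
theorem tensor_ind3 {F A B : Type*} [Field F]
    [AddCommGroup A] [Module F A] [AddCommGroup B] [Module F B]
    {f g : A ⊗[F] B → A ⊗[F] B → A ⊗[F] B → A ⊗[F] B}
    (f1 : ∀ x x' y z, f (x + x') y z = f x y z + f x' y z)
    (f2 : ∀ x y y' z, f x (y + y') z = f x y z + f x y' z)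
    (f3 : ∀ x y z z', f x y (z + z') = f x y z + f x y z')
    (g1 : ∀ x x' y z, g (x + x') y z = g x y z + g x' y z)
    (g2 : ∀ x y y' z, g x (y + y') z = g x y z + g x y' z)
    (g3 : ∀ x y z z', g x y (z + z') = g x y z + g x y z')
    (h : ∀ (x y z : A) (a b c : B),
      f (x ⊗ₜ[F] a) (y ⊗ₜ[F] b) (z ⊗ₜ[F] c) = g (x ⊗ₜ[F] a) (y ⊗ₜ[F] b) (z ⊗ₜ[F] c)) :
    ∀ x y z, f x y z = g x y z := by
  intro x y z
  induction x using TensorProduct.induction_on with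
  | zero =>
    have e1 := f1 0 0 y z
    have e2 := g1 0 0 y z
    simp only [add_zero, left_eq_add] at e1 e2
    rw [e1, e2]
  | add x x' hx hx' => rw [f1, g1, hx, hx']
  | tmul x a =>
    induction y using TensorProduct.induction_on with
    | zero =>
      have e1 := f2 (x ⊗ₜ a) 0 0 z
      have e2 := g2 (x ⊗ₜ a) 0 0 z
      simp only [add_zero, left_eq_add] at e1 e2
      rw [e1, e2]
    | add y y' hy hy' => rw [f2, g2, hy, hy']
    | tmul y b =>
      induction z using TensorProduct.induction_on with
      | zero =>
        have e1 := f3 (x ⊗ₜ a) (y ⊗ₜ b) 0 0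
        have e2 := g3 (x ⊗ₜ a) (y ⊗ₜ b) 0 0
        simp only [add_zero, left_eq_add] at e1 e2
        rw [e1, e2]
      | add z z' hz hz' => rw [f3, g3, hz, hz']
      | tmul z c => exact h x y z a b c

theorem stmt3 {F A B : Type*} [Field F] [CharZero F]
    [AddCommGroup A] [Module F A] [AddCommGroup B] [Module F B]
    (mulA : A →ₗ[F] A →ₗ[F] A) (hA : IsPermutative F mulA)
    (mulB brB : B →ₗ[F] B →ₗ[F] B) (hB : IsPoisson F mulB brB)
    (m bk : (A ⊗[F] B) →ₗ[F] (A ⊗[F] B) →ₗ[F] (A ⊗[F] B))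
    (hm : ∀ (x y : A) (a b : B),
      m (x ⊗ₜ[F] a) (y ⊗ₜ[F] b) = (mulA x y) ⊗ₜ[F] (mulB a b))
    (hbk : ∀ (x y : A) (a b : B),
      bk (x ⊗ₜ[F] a) (y ⊗ₜ[F] b) = (mulA x y) ⊗ₜ[F] (brB a b)) :
    IsDualPrePoisson F m bk := by
  obtain ⟨as, pm⟩ := hA
  obtain ⟨cm, asB, alt, jac, lei⟩ := hB
  have skew : ∀ a b, brB a b = - brB b a := by
    intro a b
    have h := alt (a + b)
    simp only [map_add, LinearMap.add_apply, alt, zero_add, add_zero] at h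
    exact eq_neg_of_add_eq_zero_right h
  have pm' : ∀ x y z, mulA y (mulA x z) = mulA (mulA x y) z := by
    intro x y z
    rw [as, pm]
  refine ⟨?_, ?_, ?_, ?_, ?_, ?_⟩
  all_goals
    apply tensor_ind3 <;> try (intros; simp only [map_add, LinearMap.add_apply, neg_add] <;> abel)
  all_goals
    intro x y z a b c
    simp only [hm, hbk]
  · rw [as, asB]
  · rw [pm, cm a b]
  · rw [pm' x y z, as, ← TensorProduct.tmul_add]
    congr 1
    have h := jac a b c
    rw [skew a (brB b c), skew b (brB a c), skew a c]
    simp only [map_neg, LinearMap.neg_apply, neg_neg]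
    rw [← sub_eq_zero, ← neg_eq_zero, ← h]
    abel
  · rw [pm' x y z, as, ← TensorProduct.tmul_add, lei]
  · rw [pm' x y z, as, ← TensorProduct.tmul_add]
    congr 1
    rw [skew, lei, skew c a, skew c b, cm (-brB a c) b]
    simp only [map_neg, LinearMap.neg_apply]
    abel
  · rw [pm y x z, skew a b, map_neg, LinearMap.neg_apply, TensorProduct.tmul_neg]
end

section
/- Let (A, ∙, {·,·}) be a Poisson algebra over a field F of characteristic 0 and let (V; μ, ρ) be a representation of (A, ∙, {·,·}). Define bilinear operations on the direct sum A ⊕ V by (x+u) ∘ (y+v) := x∙y + μ(x)v and [x+u, y+v] := {x,y} + ρ(x)v for all x,y ∈ A, u,v ∈ V. Then (A ⊕ V, ∘, [·,·]) is a dual pre-Poisson algebra. -/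
theorem stmt4 {F A V : Type*} [Field F] [CharZero F]
    [AddCommGroup A] [Module F A] [AddCommGroup V] [Module F V]
    (mul br : A →ₗ[F] A →ₗ[F] A) (h : IsPoisson F mul br)
    (μ ρ : A → (V →ₗ[F] V)) (hμlin : IsLinearMap F μ) (hρlin : IsLinearMap F ρ)
    (h1 : ∀ x y : A, μ (mul x y) = μ x ∘ₗ μ y)
    (h2 : ∀ x y : A, μ x ∘ₗ μ y = μ y ∘ₗ μ x)
    (h3 : ∀ x y : A, ρ (br x y) = ρ x ∘ₗ ρ y - ρ y ∘ₗ ρ x)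
    (h4 : ∀ x y : A, ρ (mul x y) = μ y ∘ₗ ρ x + μ x ∘ₗ ρ y)
    (h5 : ∀ x y : A, μ (br x y) = ρ x ∘ₗ μ y - μ y ∘ₗ ρ x)
    (m bk : (A × V) →ₗ[F] (A × V) →ₗ[F] (A × V))
    (hm : ∀ (x y : A) (u v : V), m (x, u) (y, v) = (mul x y, μ x v))
    (hbk : ∀ (x y : A) (u v : V), bk (x, u) (y, v) = (br x y, ρ x v)) :
    IsDualPrePoisson F m bk := by
  obtain ⟨hc, ha, h0, hj, hl⟩ := h
  have hs : ∀ x y : A, br x y = - br y x := by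
    intro x y
    have e := h0 (x + y)
    simp only [map_add, LinearMap.add_apply, h0, zero_add, add_zero] at e
    rw [add_comm] at e
    exact eq_neg_of_add_eq_zero_left e
  refine ⟨?_, ?_, ?_, ?_, ?_, ?_⟩
  all_goals
    rintro ⟨x, u⟩ ⟨y, v⟩ ⟨z, w⟩
    simp only [hm, hbk, Prod.mk_add_mk, Prod.neg_mk, Prod.mk.injEq]
  · exact ⟨(ha x y z).symm, by rw [h1]; rfl⟩
  · exact ⟨by rw [hc x y], by rw [hc x y]⟩
  · refine ⟨?_, by rw [h3]; simp⟩
    have e := hj x y z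
    rw [hs (br y z) x, hs (br z x) y, hs z x, map_neg, neg_neg] at e
    rw [← sub_eq_zero, ← neg_eq_zero, ← e]
    abel
  · exact ⟨hl x y z, by rw [h5]; simp⟩
  · refine ⟨?_, by rw [h4]; simp [add_comm]⟩
    rw [hs (mul x y) z, hl, hs z x, hs z y, map_neg, map_neg, LinearMap.neg_apply,
      hc (br x z) y]
    abel
  · refine ⟨?_, ?_⟩
    · rw [hs x y, map_neg, LinearMap.neg_apply]
    · rw [hs x y, hμlin.map_neg, LinearMap.neg_apply]
end

section
/- Let (A, ∘) be a permutative algebra over a field F of characteristic 0 and let D₁, D₂: A → A be derivations of (A, ∘) (i.e. Dᵢ(x∘y) = Dᵢ(x)∘y + x∘Dᵢ(y)) that commute: D₁D₂ = D₂D₁. Define a bilinear operation on A by [x, y] := D₁(x) ∘ D₂(y) − D₂(x) ∘ D₁(y). Then (A, [·,·]) is a Leibniz algebra, and moreover (A, ∘, [·,·]) is a dual pre-Poisson algebra. -/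
theorem stmt5 {F A : Type*} [Field F] [CharZero F] [AddCommGroup A] [Module F A]
    (mul : A →ₗ[F] A →ₗ[F] A) (hperm : IsPermutative F mul)
    (D₁ D₂ : A →ₗ[F] A)
    (hD₁ : ∀ x y : A, D₁ (mul x y) = mul (D₁ x) y + mul x (D₁ y))
    (hD₂ : ∀ x y : A, D₂ (mul x y) = mul (D₂ x) y + mul x (D₂ y))
    (hcomm : ∀ x : A, D₁ (D₂ x) = D₂ (D₁ x))
    (brk : A →ₗ[F] A →ₗ[F] A)
    (hbrk : ∀ x y : A, brk x y = mul (D₁ x) (D₂ y) - mul (D₂ x) (D₁ y)) :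
    (∀ x y z : A, brk x (brk y z) = brk (brk x y) z + brk y (brk x z)) ∧
    IsDualPrePoisson F mul brk := by
  obtain ⟨ha, hp⟩ := hperm
  have hl : ∀ x y z : A, mul x (mul y z) = mul y (mul x z) := by
    intro x y z
    rw [ha, hp, ← ha]
  have hleib : ∀ x y z : A, brk x (brk y z) = brk (brk x y) z + brk y (brk x z) := by
    intro x y z
    simp only [hbrk, hD₁, hD₂, hcomm, map_add, map_sub, LinearMap.add_apply,
      LinearMap.sub_apply, ← ha]
    simp only [hl]
    abel
  refine ⟨hleib, ha, hp, hleib, ?_, ?_, ?_⟩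
  all_goals
    intro x y z
    simp only [hbrk, hD₁, hD₂, hcomm, map_add, map_sub, LinearMap.add_apply,
      LinearMap.sub_apply, ← ha]
    try simp only [hl]
    try rw [hl (D₁ x) (D₂ y) z, hl (D₂ x) (D₁ y) z]
    abel
end

section
/- Let (A, ∘, [·,·]) be a dual pre-Poisson algebra and (B, ◇, ⊙) be a pre-Poisson algebra over a field F of characteristic 0. Define bilinear operations on A ⊗ B by (x⊗a) ◇₁ (y⊗b) = (x∘y) ⊗ (a◇b) and (x⊗a) ◇₂ (y⊗b) = [x,y] ⊗ (a⊙b) for all x,y ∈ A, a,b ∈ B. Then (A⊗B, ◇₁) and (A⊗B, ◇₂) are pre-Lie algebras, and moreover for all scalars k₁, k₂ ∈ F the bilinear operation k₁·◇₁ + k₂·◇₂ is again a pre-Lie product on A ⊗ B. -/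
open scoped TensorProduct

/-- A pre-Lie algebra structure. -/
def IsPreLie (F : Type*) {A : Type*} [Field F] [AddCommGroup A] [Module F A]
    (m : A →ₗ[F] A →ₗ[F] A) : Prop :=
  ∀ x y z : A, m x (m y z) - m (m x y) z = m y (m x z) - m (m y x) z

/-- A pre-Poisson algebra structure: a pre-Lie product `dia` and a Zinbiel
product `zin` satisfying the compatibility conditions. -/
def IsPrePoisson (F : Type*) {B : Type*} [Field F] [AddCommGroup B] [Module F B]
    (dia zin : B →ₗ[F] B →ₗ[F] B) : Prop :=
  IsPreLie F dia ∧
  (∀ x y z : B, zin x (zin y z) = zin (zin x y + zin y x) z) ∧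
  (∀ x y z : B, zin (dia x y - dia y x) z = dia x (zin y z) - zin y (dia x z)) ∧
  (∀ x y z : B, dia (zin x y + zin y x) z = zin x (dia y z) + zin y (dia x z))

/-- A trilinear expression built from two products (given in additive form) vanishes on a tensor
product as soon as it vanishes on pure tensors. -/
theorem mixed_of_tmul {F A B : Type*} [Field F]
    [AddCommGroup A] [Module F A] [AddCommGroup B] [Module F B]
    (m n : (A ⊗[F] B) →ₗ[F] (A ⊗[F] B) →ₗ[F] (A ⊗[F] B))
    (h : ∀ (x y z : A) (a b c : B),
      m (x ⊗ₜ[F] a) (n (y ⊗ₜ[F] b) (z ⊗ₜ[F] c)) - m (n (x ⊗ₜ[F] a) (y ⊗ₜ[F] b)) (z ⊗ₜ[F] c)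
      + (n (x ⊗ₜ[F] a) (m (y ⊗ₜ[F] b) (z ⊗ₜ[F] c)) - n (m (x ⊗ₜ[F] a) (y ⊗ₜ[F] b)) (z ⊗ₜ[F] c))
      - (m (y ⊗ₜ[F] b) (n (x ⊗ₜ[F] a) (z ⊗ₜ[F] c)) - m (n (y ⊗ₜ[F] b) (x ⊗ₜ[F] a)) (z ⊗ₜ[F] c))
      - (n (y ⊗ₜ[F] b) (m (x ⊗ₜ[F] a) (z ⊗ₜ[F] c)) - n (m (y ⊗ₜ[F] b) (x ⊗ₜ[F] a)) (z ⊗ₜ[F] c))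
        = 0) (u v w : A ⊗[F] B) :
    m u (n v w) - m (n u v) w + (n u (m v w) - n (m u v) w)
      - (m v (n u w) - m (n v u) w) - (n v (m u w) - n (m v u) w) = 0 := by
  induction u using TensorProduct.induction_on with
  | zero => simp
  | add u₁ u₂ h₁ h₂ =>
    have := congrArg₂ (· + ·) h₁ h₂
    simp only [map_add, LinearMap.add_apply, add_zero] at this ⊢
    rw [← this]; abel
  | tmul x a =>
  induction v using TensorProduct.induction_on with
  | zero => simp
  | add u₁ u₂ h₁ h₂ =>
    have := congrArg₂ (· + ·) h₁ h₂
    simp only [map_add, LinearMap.add_apply, add_zero] at this ⊢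
    rw [← this]; abel
  | tmul y b =>
  induction w using TensorProduct.induction_on with
  | zero => simp
  | add u₁ u₂ h₁ h₂ =>
    have := congrArg₂ (· + ·) h₁ h₂
    simp only [map_add, LinearMap.add_apply, add_zero] at this ⊢
    rw [← this]; abel
  | tmul z c => exact h x y z a b c

/-- The diagonal case of the mixed identity is the pre-Lie identity. -/
theorem preLie_of_mixed {F V : Type*} [Field F] [CharZero F] [AddCommGroup V] [Module F V]
    (m : V →ₗ[F] V →ₗ[F] V)
    (h : ∀ u v w : V, m u (m v w) - m (m u v) w + (m u (m v w) - m (m u v) w)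
      - (m v (m u w) - m (m v u) w) - (m v (m u w) - m (m v u) w) = 0) : IsPreLie F m := by
  intro u v w
  have h2 : (2 : F) • ((m u (m v w) - m (m u v) w) - (m v (m u w) - m (m v u) w)) = 0 := by
    rw [← h u v w]; module
  exact sub_eq_zero.mp ((smul_eq_zero.mp h2).resolve_left two_ne_zero)

theorem stmt6 {F A B : Type*} [Field F] [CharZero F]
    [AddCommGroup A] [Module F A] [AddCommGroup B] [Module F B]
    (mulA brA : A →ₗ[F] A →ₗ[F] A) (hA : IsDualPrePoisson F mulA brA)
    (dia zin : B →ₗ[F] B →ₗ[F] B) (hB : IsPrePoisson F dia zin)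
    (m₁ m₂ : (A ⊗[F] B) →ₗ[F] (A ⊗[F] B) →ₗ[F] (A ⊗[F] B))
    (hm₁ : ∀ (x y : A) (a b : B),
      m₁ (x ⊗ₜ[F] a) (y ⊗ₜ[F] b) = (mulA x y) ⊗ₜ[F] (dia a b))
    (hm₂ : ∀ (x y : A) (a b : B),
      m₂ (x ⊗ₜ[F] a) (y ⊗ₜ[F] b) = (brA x y) ⊗ₜ[F] (zin a b)) :
    IsPreLie F m₁ ∧ IsPreLie F m₂ ∧ ∀ k₁ k₂ : F, IsPreLie F (k₁ • m₁ + k₂ • m₂) := by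
  obtain ⟨a1, a2, a3, a4, a5, a6⟩ := hA
  obtain ⟨b1, b2, b3, b4⟩ := hB
  have p₁ : IsPreLie F m₁ := by
    refine preLie_of_mixed m₁ (mixed_of_tmul m₁ m₁ fun x y z a b c => ?_)
    simp only [hm₁, a1]
    rw [a2 y x z]
    have e := congrArg (fun t => (mulA (mulA x y) z) ⊗ₜ[F] t) (b1 a b c)
    simp only [TensorProduct.tmul_sub] at e
    rw [e]; abel
  have p₂ : IsPreLie F m₂ := by
    refine preLie_of_mixed m₂ (mixed_of_tmul m₂ m₂ fun x y z a b c => ?_)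
    have e1 : brA (brA x y) z = brA x (brA y z) - brA y (brA x z) := by rw [a3 x y z]; abel
    have e2 : brA (brA y x) z = brA y (brA x z) - brA x (brA y z) := by rw [a3 y x z]; abel
    simp only [hm₂, e1, e2, b2, map_add, LinearMap.add_apply, TensorProduct.tmul_add,
      TensorProduct.sub_tmul]
    abel
  have mixed := mixed_of_tmul m₁ m₂ fun x y z a b c => by
    have e1 : dia a (zin b c) = zin (dia a b) c - zin (dia b a) c + zin b (dia a c) := by
      have := b3 a b c
      simp only [map_sub, LinearMap.sub_apply] at this
      rw [this]; abel
    have e2 : dia b (zin a c) = zin (dia b a) c - zin (dia a b) c + zin a (dia b c) := by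
      have := b3 b a c
      simp only [map_sub, LinearMap.sub_apply] at this
      rw [this]; abel
    have e3 : dia (zin a b) c = zin a (dia b c) + zin b (dia a c) - dia (zin b a) c := by
      rw [← b4 a b c]; simp
    simp only [hm₁, hm₂, a4, a5, a6 y x z, e1, e2, e3, TensorProduct.tmul_add,
      TensorProduct.tmul_sub, TensorProduct.add_tmul, TensorProduct.neg_tmul]
    abel
  refine ⟨p₁, p₂, fun k₁ k₂ u v w => ?_⟩
  have q₁ := sub_eq_zero.mpr (p₁ u v w)
  have q₂ := sub_eq_zero.mpr (p₂ u v w)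
  have q := mixed u v w
  rw [← sub_eq_zero]
  have key := congrArg₂ (· + ·) (congrArg₂ (· + ·) (congrArg ((k₁ * k₁) • ·) q₁)
    (congrArg ((k₂ * k₂) • ·) q₂)) (congrArg ((k₁ * k₂) • ·) q)
  simp only [smul_zero, add_zero] at key
  rw [← key]
  simp only [LinearMap.add_apply, LinearMap.smul_apply, map_add, map_smul]
  module
end

section
/- Let (A, ∘) be a permutative algebra over a field F of characteristic 0, and let (▷ᵢ)_{i≥0} and (◁ᵢ)_{i≥0} be sequences of bilinear operations on A with x ▷₀ y = x∘y and x ◁₀ y = y∘x for all x,y ∈ A, such that for every k ≥ 0 and all x,y,z ∈ A the following five identities hold: Σ_{i+j=k} ((x▷ᵢy)▷ⱼz − x▷ᵢ(y▷ⱼz)) = 0; Σ_{i+j=k} ((x◁ᵢy)◁ⱼz − x◁ᵢ(y▷ⱼz)) = 0; Σ_{i+j=k} ((x▷ᵢy)◁ⱼz − x▷ᵢ(y◁ⱼz)) = 0; Σ_{i+j=k} ((x◁ᵢy)▷ⱼz − x▷ᵢ(y▷ⱼz)) = 0; Σ_{i+j=k} ((x◁ᵢy)◁ⱼz − x◁ᵢ(y◁ⱼz))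 = 0. Define a bilinear operation on A by [x, y] := x ▷₁ y − y ◁₁ x. Then (A, ∘, [·,·]) is a dual pre-Poisson algebra. -/
/-- Semi-classical limit of a diassociative formal deformation of a permutative
algebra: `tri i` is `▷ᵢ`, `lef i` is `◁ᵢ`, and the five summed identities say
that the formal power series operations make `A[[ℏ]]` a diassociative algebra. -/
theorem stmt7 {F A : Type*} [Field F] [CharZero F] [AddCommGroup A] [Module F A]
    (mul : A →ₗ[F] A →ₗ[F] A) (hperm : IsPermutative F mul)
    (tri lef : ℕ → (A →ₗ[F] A →ₗ[F] A))
    (h0t : ∀ x y : A, tri 0 x y = mul x y)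
    (h0l : ∀ x y : A, lef 0 x y = mul y x)
    (h1 : ∀ (k : ℕ) (x y z : A),
      ∑ i ∈ Finset.range (k + 1),
        (tri (k - i) (tri i x y) z - tri i x (tri (k - i) y z)) = 0)
    (h2 : ∀ (k : ℕ) (x y z : A),
      ∑ i ∈ Finset.range (k + 1),
        (lef (k - i) (lef i x y) z - lef i x (tri (k - i) y z)) = 0)
    (h3 : ∀ (k : ℕ) (x y z : A),
      ∑ i ∈ Finset.range (k + 1),
        (lef (k - i) (tri i x y) z - tri i x (lef (k - i) y z)) = 0)
    (h4 : ∀ (k : ℕ) (x y z : A),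
      ∑ i ∈ Finset.range (k + 1),
        (tri (k - i) (lef i x y) z - tri i x (tri (k - i) y z)) = 0)
    (h5 : ∀ (k : ℕ) (x y z : A),
      ∑ i ∈ Finset.range (k + 1),
        (lef (k - i) (lef i x y) z - lef i x (lef (k - i) y z)) = 0)
    (brk : A →ₗ[F] A →ₗ[F] A)
    (hbrk : ∀ x y : A, brk x y = tri 1 x y - lef 1 y x) :
    IsDualPrePoisson F mul brk := by
  refine ⟨hperm.1, hperm.2, ?_, ?_, ?_, ?_⟩ <;> intro x y z
  · have e0 := h1 2 x y z
    have e1 := h2 2 z x y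
    have e2 := h3 2 x z y
    have e3 := h3 2 y z x
    have e4 := h4 2 y x z
    have e5 := h5 2 z y x
    simp only [Finset.sum_range_succ, Finset.sum_range_zero, h0t, h0l, Nat.sub_zero, Nat.sub_self,
      Nat.reduceSub, zero_add] at e0 e1 e2 e3 e4 e5
    simp only [hbrk, map_sub, LinearMap.sub_apply]
    linear_combination (norm := module) - e0 - e1 + e2 - e3 + e4 + e5
  · have e0 := h1 1 x y z
    have e1 := h3 1 y z x
    have e2 := h4 1 y x z
    simp only [Finset.sum_range_succ, Finset.sum_range_zero, h0t, h0l, Nat.sub_zero, Nat.sub_self,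
      Nat.reduceSub, zero_add] at e0 e1 e2
    simp only [hbrk, map_sub, LinearMap.sub_apply]
    linear_combination (norm := module) - e0 - e1 + e2
  · have e0 := h1 1 x y z
    have e1 := h2 1 z x y
    have e2 := h3 1 x z y
    simp only [Finset.sum_range_succ, Finset.sum_range_zero, h0t, h0l, Nat.sub_zero, Nat.sub_self,
      Nat.reduceSub, zero_add] at e0 e1 e2
    simp only [hbrk, map_sub, LinearMap.sub_apply]
    linear_combination (norm := module)  e0 + e1 - e2
  · have e0 := h1 1 x y z
    have e1 := h1 1 y x z
    have e2 := h4 1 x y z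
    have e3 := h4 1 y x z
    simp only [Finset.sum_range_succ, Finset.sum_range_zero, h0t, h0l, Nat.sub_zero, Nat.sub_self,
      Nat.reduceSub, zero_add] at e0 e1 e2 e3
    simp only [hbrk, map_sub, LinearMap.sub_apply]
    linear_combination (norm := module)  e0 + e1 - e2 - e3
end

section
/- Let (A, ∘, [·,·]) be a dual pre-Poisson algebra over a field F of characteristic 0, let V be a vector space, and let l∘, r∘, l, r: A → End(V) be linear maps. Define bilinear operations on A ⊕ V by (x+u) ∘' (y+v) := x∘y + l∘(x)v + r∘(y)u and [x+u, y+v]' := [x,y] + l(x)v + r(y)u. Then (V; l∘, r∘, l, r) is a representation of (A, ∘, [·,·]) if and only if (A ⊕ V, ∘', [·,·]') is a dual pre-Poisson algebra. -/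
/-- A representation of a dual pre-Poisson algebra `(A, mul, br)` on `V`:
four linear maps `lc rc lb rb : A → End(V)` satisfying the compatibility
conditions of Definition 2.22. -/
def IsDppRep (F : Type*) {A V : Type*} [Field F] [AddCommGroup A] [Module F A]
    [AddCommGroup V] [Module F V]
    (mul br : A →ₗ[F] A →ₗ[F] A)
    (lc rc lb rb : A → (V →ₗ[F] V)) : Prop :=
  IsLinearMap F lc ∧ IsLinearMap F rc ∧ IsLinearMap F lb ∧ IsLinearMap F rb ∧
  (∀ x y : A, rc x ∘ₗ rc y = rc (mul y x)) ∧
  (∀ x y : A, rc (mul y x) = lc y ∘ₗ rc x) ∧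
  (∀ x y : A, lc y ∘ₗ rc x = rc x ∘ₗ lc y) ∧
  (∀ x y : A, lc (mul x y) = lc x ∘ₗ lc y) ∧
  (∀ x y : A, lc x ∘ₗ lc y = lc y ∘ₗ lc x) ∧
  (∀ x y : A, lb (br x y) = lb x ∘ₗ lb y - lb y ∘ₗ lb x) ∧
  (∀ x y : A, rb (br x y) = rb y ∘ₗ rb x + lb x ∘ₗ rb y) ∧
  (∀ x y : A, rb x ∘ₗ rb y = -(rb x ∘ₗ lb y)) ∧
  (∀ x y : A, rb (mul x y) = rc y ∘ₗ rb x + lc x ∘ₗ rb y) ∧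
  (∀ x y : A, lb x ∘ₗ rc y = rc y ∘ₗ lb x + rc (br x y)) ∧
  (∀ x y : A, lb x ∘ₗ lc y = lc (br x y) + lc y ∘ₗ lb x) ∧
  (∀ x y : A, rb x ∘ₗ rc y = rc (br y x) + lc y ∘ₗ rb x) ∧
  (∀ x y : A, lb (mul x y) = lc x ∘ₗ lb y + lc y ∘ₗ lb x) ∧
  (∀ x y : A, rb x ∘ₗ (lc y - rc y) = 0) ∧
  (∀ x y : A, rc x ∘ₗ (lb y + rb y) = 0) ∧
  (∀ x y : A, lc (br x y + br y x) = 0)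

theorem stmt8 {F A V : Type*} [Field F] [CharZero F] [AddCommGroup A] [Module F A]
    [AddCommGroup V] [Module F V]
    (mul br : A →ₗ[F] A →ₗ[F] A) (h : IsDualPrePoisson F mul br)
    (lc rc lb rb : A → (V →ₗ[F] V))
    (m bk : (A × V) →ₗ[F] (A × V) →ₗ[F] (A × V))
    (hm : ∀ (x y : A) (u v : V), m (x, u) (y, v) = (mul x y, lc x v + rc y u))
    (hbk : ∀ (x y : A) (u v : V), bk (x, u) (y, v) = (br x y, lb x v + rb y u)) :
    IsDppRep F mul br lc rc lb rb ↔ IsDualPrePoisson F m bk := by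
  obtain ⟨a1, a2, a3, a4, a5, a6⟩ := h
  have lin : IsLinearMap F lc ∧ IsLinearMap F rc ∧ IsLinearMap F lb ∧ IsLinearMap F rb := by
    refine ⟨⟨fun x y => ?_, fun c x => ?_⟩, ⟨fun x y => ?_, fun c x => ?_⟩,
      ⟨fun x y => ?_, fun c x => ?_⟩, ⟨fun x y => ?_, fun c x => ?_⟩⟩ <;> ext v
    · have := congrArg Prod.snd (LinearMap.map_add₂ m (x, 0) (y, 0) (0, v))
      simpa [-LinearMap.map_add₂, -map_add, hm] using this
    · have := congrArg Prod.snd (LinearMap.map_smul₂ m c (x, 0) (0, v))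
      simpa [-LinearMap.map_smul₂, -map_smul, hm] using this
    · have := congrArg Prod.snd ((m (0, v)).map_add (x, 0) (y, 0))
      simpa [-map_add, hm] using this
    · have := congrArg Prod.snd ((m (0, v)).map_smul c (x, 0))
      simpa [-map_smul, hm] using this
    · have := congrArg Prod.snd (LinearMap.map_add₂ bk (x, 0) (y, 0) (0, v))
      simpa [-LinearMap.map_add₂, -map_add, hbk] using this
    · have := congrArg Prod.snd (LinearMap.map_smul₂ bk c (x, 0) (0, v))
      simpa [-LinearMap.map_smul₂, -map_smul, hbk] using this
    · have := congrArg Prod.snd ((bk (0, v)).map_add (x, 0) (y, 0))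
      simpa [-map_add, hbk] using this
    · have := congrArg Prod.snd ((bk (0, v)).map_smul c (x, 0))
      simpa [-map_smul, hbk] using this
  obtain ⟨l1, l2, l3, l4⟩ := lin
  constructor
  · rintro ⟨-, -, -, -, b1, b2, b3, b4, b5, b6, b7, b8, b9, b10, b11, b12, b13, b14, b15, b16⟩
    simp only [l1.map_add, LinearMap.ext_iff, LinearMap.comp_apply, LinearMap.add_apply,
      LinearMap.sub_apply, LinearMap.neg_apply, LinearMap.zero_apply, map_add, map_sub]
      at b1 b2 b3 b4 b5 b6 b7 b8 b9 b10 b11 b12 b13 b14 b15 b16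
    refine ⟨?_, ?_, ?_, ?_, ?_, ?_⟩ <;> rintro ⟨x, u⟩ ⟨y, v⟩ ⟨z, w⟩ <;>
      simp only [hm, hbk, Prod.mk_add_mk, Prod.neg_mk, Prod.mk.injEq, map_add]
    · refine ⟨a1 x y z, ?_⟩
      rw [b4, b3, ← b1]; abel
    · refine ⟨a2 x y z, ?_⟩
      rw [b4, b4, b5, b1, b2, b3, b1, b2, b3]; abel
    · refine ⟨a3 x y z, ?_⟩
      rw [b6, b7, b7, b8 z x]; abel
    · refine ⟨a4 x y z, ?_⟩
      rw [b11, b10, b9]; abel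
    · refine ⟨a5 x y z, ?_⟩
      rw [b13, sub_eq_zero.1 (b14 z x v), b12, b12]; abel
    · refine ⟨a6 x y z, ?_⟩
      rw [eq_neg_of_add_eq_zero_left (b16 x y w), eq_neg_of_add_eq_zero_left (b15 z x v),
        eq_neg_of_add_eq_zero_left (b15 z y u)]; abel
  · rintro ⟨c1, c2, c3, c4, c5, c6⟩
    have key : ∀ {p q : A × V}, p = q → p.2 = q.2 := fun h => congrArg Prod.snd h
    have d1 := fun x y w => key (c1 (x, 0) (y, 0) (0, w))
    have d2 := fun x z v => key (c1 (x, 0) (0, v) (z, 0))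
    have d3 := fun y z u => key (c1 (0, u) (y, 0) (z, 0))
    have e1 := fun x y w => key (c2 (x, 0) (y, 0) (0, w))
    have e2 := fun y z u => key (c2 (0, u) (y, 0) (z, 0))
    have f1 := fun x y w => key (c3 (x, 0) (y, 0) (0, w))
    have f2 := fun x z v => key (c3 (x, 0) (0, v) (z, 0))
    have f3 := fun y z u => key (c3 (0, u) (y, 0) (z, 0))
    have g1 := fun x y w => key (c4 (x, 0) (y, 0) (0, w))
    have g2 := fun x z v => key (c4 (x, 0) (0, v) (z, 0))
    have g3 := fun y z u => key (c4 (0, u) (y, 0) (z, 0))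
    have h1 := fun x y w => key (c5 (x, 0) (y, 0) (0, w))
    have h2 := fun x z v => key (c5 (x, 0) (0, v) (z, 0))
    have h3 := fun y z u => key (c5 (0, u) (y, 0) (z, 0))
    have i1 := fun x y w => key (c6 (x, 0) (y, 0) (0, w))
    have i2 := fun y z u => key (c6 (0, u) (y, 0) (z, 0))
    clear c1 c2 c3 c4 c5 c6
    simp only [hm, hbk, Prod.mk_add_mk, Prod.neg_mk, map_zero, LinearMap.zero_apply, l1.map_zero,
      l2.map_zero, l3.map_zero, l4.map_zero, add_zero, zero_add]
      at d1 d2 d3 e1 e2 f1 f2 f3 g1 g2 g3 h1 h2 h3 i1 i2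
    refine ⟨l1, l2, l3, l4, ?_, ?_, ?_, ?_, ?_, ?_, ?_, ?_, ?_, ?_, ?_, ?_, ?_, ?_, ?_, ?_⟩ <;>
      intro x y <;> ext v <;>
      simp only [l1.map_add, LinearMap.comp_apply, LinearMap.add_apply,
        LinearMap.sub_apply, LinearMap.neg_apply, LinearMap.zero_apply, map_add, map_sub]
    · rw [d3]
    · rw [d3, e2, d2]
    · rw [d2]
    · rw [d1]
    · rw [d1, d1, e1]
    · rw [f1]; abel
    · rw [f3]
    · have p := f2 y x v
      rw [f3] at p
      rw [eq_neg_iff_add_eq_zero]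
      have : lb y (rb x v) + (rb x (rb y v) + rb x (lb y v)) = lb y (rb x v) + 0 := by
        rw [add_zero]; nth_rewrite 2 [p]; abel
      exact add_left_cancel this
    · rw [g3]
    · rw [g2]
    · rw [g1]
    · rw [h3]
    · rw [h1]
    · rw [h2, h3]; abel
    · rw [i2]; abel
    · rw [i1]; abel
end

section
/- Let (A, ∙, {·,·}) be a finite-dimensional Poisson algebra over a field F of characteristic 0. Define bilinear operations on A ⊕ A* by (x + a*) ∘ (y + b*) := x∙y − L∙*(x)b* and [x + a*, y + b*] := {x,y} + ad*(x)b*, where ⟨L∙*(x)b*, z⟩ = −⟨b*, x∙z⟩ and ⟨ad*(x)b*, z⟩ = −⟨b*, {x,z}⟩ for all x,y,z ∈ A, a*,b* ∈ A*, and define the bilinear form B on A ⊕ A* by B(x + a*, y + b*) = ⟨y, a*⟩ − ⟨x, b*⟩. Then (A ⊕ A*, ∘, [·,·], B) is a quadratic dual pre-Poisson algebra; in particular B is nondegenerate, skew-symmetric, and invariant. -/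
/-- For a bilinear operation `m` on `A`, the dual of left multiplication:
`⟨(leftStar m x) b*, z⟩ = −⟨b*, m x z⟩`.  For `m = mul` this is `L∙*`, for
`m = br` it is `ad*`. -/
def leftStar {F A : Type*} [Field F] [AddCommGroup A] [Module F A]
    (m : A →ₗ[F] A →ₗ[F] A) (x : A) :
    Module.Dual F A →ₗ[F] Module.Dual F A :=
  -((m x).dualMap)

/-- The standard bilinear form `B(x + a*, y + b*) = ⟨y, a*⟩ − ⟨x, b*⟩`
on `A ⊕ A*`. -/
def pairForm (F : Type*) {A : Type*} [Field F] [AddCommGroup A] [Module F A]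
    (p q : A × Module.Dual F A) : F :=
  p.2 q.1 - q.2 p.1

theorem stmt10 {F A : Type*} [Field F] [CharZero F] [AddCommGroup A] [Module F A]
    [FiniteDimensional F A]
    (mul br : A →ₗ[F] A →ₗ[F] A) (h : IsPoisson F mul br)
    (m bk : (A × Module.Dual F A) →ₗ[F] (A × Module.Dual F A) →ₗ[F] (A × Module.Dual F A))
    (hm : ∀ (x y : A) (α β : Module.Dual F A),
      m (x, α) (y, β) = (mul x y, -(leftStar mul x β)))
    (hbk : ∀ (x y : A) (α β : Module.Dual F A),
      bk (x, α) (y, β) = (br x y, leftStar br x β)) :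
    IsDualPrePoisson F m bk ∧
    (∀ p q : A × Module.Dual F A, pairForm F p q = - pairForm F q p) ∧
    (∀ p : A × Module.Dual F A, (∀ q, pairForm F p q = 0) → p = 0) ∧
    (∀ p q s : A × Module.Dual F A, pairForm F (m p q) s = pairForm F p (m q s - m s q)) ∧
    (∀ p q s : A × Module.Dual F A, pairForm F (bk p q) s = pairForm F p (bk q s + bk s q)) := by
  obtain ⟨hc, ha, hs, hj, hl⟩ := h
  have hk : ∀ x y : A, br x y = - br y x := by
    intro x y
    have h1 := hs (x + y)
    simp only [map_add, LinearMap.add_apply, hs, zero_add, add_zero] at h1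
    exact eq_neg_of_add_eq_zero_right h1
  -- the Jacobi identity in Leibniz form
  have hJ : ∀ x y z : A, br x (br y z) = br (br x y) z + br y (br x z) := by
    intro x y z
    have h1 := hj x y z
    rw [hk (br y z) x, hk (br z x) y, hk z x, map_neg, neg_neg] at h1
    rw [← sub_eq_zero, ← neg_eq_zero, ← h1]
    abel
  -- the bracket is a derivation in its first argument
  have hr : ∀ x y z : A, br (mul x y) z = mul x (br y z) + mul y (br x z) := by
    intro x y z
    rw [hk, hl, hk z x, hk z y, hc _ y]
    simp only [map_neg]
    abel
  have hD : ∀ x y w : A, br (mul x y) w = br y (mul x w) + br x (mul y w) := by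
    intro x y w
    rw [hr, hl, hl, hk y x]
    simp only [map_neg, LinearMap.neg_apply]
    abel
  refine ⟨⟨?_, ?_, ?_, ?_, ?_, ?_⟩, ?_, ?_, ?_, ?_⟩
  · rintro ⟨x, α⟩ ⟨y, β⟩ ⟨z, γ⟩
    simp only [hm]
    refine Prod.ext (ha x y z).symm (LinearMap.ext fun w => ?_)
    simp [leftStar, hc x y, ha]
  · rintro ⟨x, α⟩ ⟨y, β⟩ ⟨z, γ⟩
    simp only [hm, hc x y]
  · rintro ⟨x, α⟩ ⟨y, β⟩ ⟨z, γ⟩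
    simp only [hbk]
    refine Prod.ext (hJ x y z) (LinearMap.ext fun w => ?_)
    simp [leftStar, hJ x y w]
  · rintro ⟨x, α⟩ ⟨y, β⟩ ⟨z, γ⟩
    simp only [hm, hbk]
    refine Prod.ext (hl x y z) (LinearMap.ext fun w => ?_)
    simp [leftStar, hl x y w]
  · rintro ⟨x, α⟩ ⟨y, β⟩ ⟨z, γ⟩
    simp only [hm, hbk]
    refine Prod.ext (hr x y z) (LinearMap.ext fun w => ?_)
    simp [leftStar, hD x y w, add_comm]
  · rintro ⟨x, α⟩ ⟨y, β⟩ ⟨z, γ⟩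
    simp only [hm, hbk]
    refine Prod.ext ?_ (LinearMap.ext fun w => ?_)
    · simp [hk x y]
    · simp [leftStar, hk x y]
  · intro p q
    simp [pairForm]
  · rintro ⟨x, α⟩ hp
    refine Prod.ext ?_ (LinearMap.ext fun w => ?_)
    · refine (Module.forall_dual_apply_eq_zero_iff F x).1 fun f => ?_
      simpa [pairForm] using hp (0, f)
    · simpa [pairForm] using hp (w, 0)
  · rintro ⟨x, α⟩ ⟨y, β⟩ ⟨z, γ⟩
    simp [pairForm, hm, leftStar, hc z y, hc z x, hc y x]
  · rintro ⟨x, α⟩ ⟨y, β⟩ ⟨z, γ⟩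
    simp [pairForm, hbk, leftStar, hk z y, hk z x, hk y x]
    try ring
end

section
/- Let (A, ∘) be a permutative algebra over a field F of characteristic 0 with a nondegenerate skew-symmetric bilinear form B satisfying B(x∘y, z) = B(x, y∘z − z∘y) for all x,y,z ∈ A, and let D₁, D₂: A → A be commuting derivations of (A, ∘) that are skew-symmetric with respect to B, i.e. B(Dᵢ(x), y) + B(x, Dᵢ(y)) = 0 for i ∈ {1,2} and all x,y ∈ A. Define [x, y] := D₁(x) ∘ D₂(y) − D₂(x) ∘ D₁(y). Then (A, ∘, [·,·], B) is a quadratic dual pre-Poisson algebra; in particular B([x,y], z) = B(x, [y,z] + [z,y]) for all x,y,z ∈ A. -/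
theorem stmt11 {F A : Type*} [Field F] [CharZero F] [AddCommGroup A] [Module F A]
    (mul : A →ₗ[F] A →ₗ[F] A) (hperm : IsPermutative F mul)
    (B : A →ₗ[F] A →ₗ[F] F)
    (hskew : ∀ x y : A, B x y = - B y x)
    (hnd : ∀ x : A, (∀ y : A, B x y = 0) → x = 0)
    (hinv : ∀ x y z : A, B (mul x y) z = B x (mul y z - mul z y))
    (D₁ D₂ : A →ₗ[F] A)
    (hD₁ : ∀ x y : A, D₁ (mul x y) = mul (D₁ x) y + mul x (D₁ y))
    (hD₂ : ∀ x y : A, D₂ (mul x y) = mul (D₂ x) y + mul x (D₂ y))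
    (hcomm : ∀ x : A, D₁ (D₂ x) = D₂ (D₁ x))
    (hD₁skew : ∀ x y : A, B (D₁ x) y + B x (D₁ y) = 0)
    (hD₂skew : ∀ x y : A, B (D₂ x) y + B x (D₂ y) = 0)
    (brk : A →ₗ[F] A →ₗ[F] A)
    (hbrk : ∀ x y : A, brk x y = mul (D₁ x) (D₂ y) - mul (D₂ x) (D₁ y)) :
    IsDualPrePoisson F mul brk ∧
    (∀ x y z : A, B (brk x y) z = B x (brk y z + brk z y)) := by
  obtain ⟨h1, h2⟩ := hperm
  have ha : ∀ x y z : A, mul (mul x y) z = mul x (mul y z) := fun x y z => (h1 x y z).symm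
  have hl : ∀ x y z : A, mul x (mul y z) = mul y (mul x z) := fun x y z => by
    rw [h1, h2, ha]
  refine ⟨⟨h1, h2, ?_, ?_, ?_, ?_⟩, ?_⟩
  · intro x y z
    simp only [hbrk, hD₁, hD₂, map_sub, map_add, LinearMap.sub_apply, LinearMap.add_apply, ha,
      hcomm]
    simp only [hl (D₁ y), hl (D₂ y), hl (D₂ (D₁ y)), hl (D₁ (D₁ y)), hl (D₂ (D₂ y))]
    abel
  · intro x y z
    simp only [hbrk, hD₁, hD₂, map_sub, map_add, LinearMap.sub_apply, ha]
    simp only [hl y]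
    abel
  · intro x y z
    simp only [hbrk, hD₁, hD₂, map_sub, map_add, LinearMap.add_apply, ha]
    simp only [hl x, hl y]
    abel
  · intro x y z
    simp only [hbrk, map_sub, LinearMap.sub_apply, ha]
    rw [hl (D₁ x), hl (D₂ x)]
    abel
  · intro x y z
    have e1 : ∀ x y : A, B (D₁ x) y = - B x (D₁ y) := fun x y =>
      eq_neg_of_add_eq_zero_left (hD₁skew x y)
    have e2 : ∀ x y : A, B (D₂ x) y = - B x (D₂ y) := fun x y =>
      eq_neg_of_add_eq_zero_left (hD₂skew x y)
    simp only [hbrk, map_sub, LinearMap.sub_apply, hinv, e1, e2, hD₁, hD₂, map_add, hcomm]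
    ring
end

section
/- Let (A, ⋆, B_A) be a finite-dimensional quadratic permutative algebra and (B, ∙, {·,·}, B_B) be a finite-dimensional quadratic Poisson algebra over a field F of characteristic 0. Define bilinear operations on A ⊗ B by (x⊗a) ∘ (y⊗b) = (x⋆y) ⊗ (a∙b) and [x⊗a, y⊗b] = (x⋆y) ⊗ {a,b}, and define the bilinear form B_{A⊗B}(x⊗a, y⊗b) := B_A(x,y)·B_B(a,b). Then (A⊗B, ∘, [·,·], B_{A⊗B}) is a quadratic dual pre-Poisson algebra; in particular B_{A⊗B} is nondegenerate, skew-symmetric, and invariant. -/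
open scoped TensorProduct

/-- A function on triples of tensors, additive in each argument, vanishes if it vanishes on
pure tensors. -/
theorem tri_zero {F A B M : Type*} [Field F] [AddCommGroup A] [Module F A]
    [AddCommGroup B] [Module F B] [AddCommGroup M]
    (D : A ⊗[F] B → A ⊗[F] B → A ⊗[F] B → M)
    (h1 : ∀ s s' t u, D (s + s') t u = D s t u + D s' t u)
    (h2 : ∀ s t t' u, D s (t + t') u = D s t u + D s t' u)
    (h3 : ∀ s t u u', D s t (u + u') = D s t u + D s t u')
    (h : ∀ (x y z : A) (a b c : B), D (x ⊗ₜ[F] a) (y ⊗ₜ[F] b) (z ⊗ₜ[F] c) = 0)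
    (s t u : A ⊗[F] B) : D s t u = 0 := by
  induction s with
  | zero => simpa using h1 0 0 t u
  | add s s' hs hs' => rw [h1, hs, hs', add_zero]
  | tmul x a =>
    induction t with
    | zero => simpa using h2 (x ⊗ₜ[F] a) 0 0 u
    | add s s' hs hs' => rw [h2, hs, hs', add_zero]
    | tmul y b =>
      induction u with
      | zero => simpa using h3 (x ⊗ₜ[F] a) (y ⊗ₜ[F] b) 0 0
      | add s s' hs hs' => rw [h3, hs, hs', add_zero]
      | tmul z c => exact h x y z a b c

theorem stmt12 {F A B : Type*} [Field F] [CharZero F]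
    [AddCommGroup A] [Module F A] [FiniteDimensional F A]
    [AddCommGroup B] [Module F B] [FiniteDimensional F B]
    (mulA : A →ₗ[F] A →ₗ[F] A) (hA : IsPermutative F mulA)
    (BA : A →ₗ[F] A →ₗ[F] F)
    (hBAskew : ∀ x y : A, BA x y = - BA y x)
    (hBAnd : ∀ x : A, (∀ y : A, BA x y = 0) → x = 0)
    (hBAinv : ∀ x y z : A, BA (mulA x y) z = BA x (mulA y z - mulA z y))
    (mulB brB : B →ₗ[F] B →ₗ[F] B) (hB : IsPoisson F mulB brB)
    (BB : B →ₗ[F] B →ₗ[F] F)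
    (hBBsymm : ∀ a b : B, BB a b = BB b a)
    (hBBnd : ∀ a : B, (∀ b : B, BB a b = 0) → a = 0)
    (hBBinv1 : ∀ a b c : B, BB (mulB a b) c = BB a (mulB b c))
    (hBBinv2 : ∀ a b c : B, BB (brB a b) c = BB a (brB b c))
    (m bk : (A ⊗[F] B) →ₗ[F] (A ⊗[F] B) →ₗ[F] (A ⊗[F] B))
    (hm : ∀ (x y : A) (a b : B),
      m (x ⊗ₜ[F] a) (y ⊗ₜ[F] b) = (mulA x y) ⊗ₜ[F] (mulB a b))
    (hbk : ∀ (x y : A) (a b : B),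
      bk (x ⊗ₜ[F] a) (y ⊗ₜ[F] b) = (mulA x y) ⊗ₜ[F] (brB a b))
    (BT : (A ⊗[F] B) →ₗ[F] (A ⊗[F] B) →ₗ[F] F)
    (hBT : ∀ (x y : A) (a b : B),
      BT (x ⊗ₜ[F] a) (y ⊗ₜ[F] b) = BA x y * BB a b) :
    IsDualPrePoisson F m bk ∧
    (∀ s t : A ⊗[F] B, BT s t = - BT t s) ∧
    (∀ s : A ⊗[F] B, (∀ t : A ⊗[F] B, BT s t = 0) → s = 0) ∧
    (∀ s t u : A ⊗[F] B, BT (m s t) u = BT s (m t u - m u t)) ∧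
    (∀ s t u : A ⊗[F] B, BT (bk s t) u = BT s (bk t u + bk u t)) := by
  obtain ⟨as, pm⟩ := hA
  obtain ⟨cm, asB, alt, jac, lz⟩ := hB
  have sk : ∀ a b, brB a b = - brB b a := by
    intro a b
    have h := alt (a + b)
    simp only [map_add, LinearMap.add_apply, alt, zero_add, add_zero] at h
    first
      | exact eq_neg_of_add_eq_zero_left h
      | exact eq_neg_of_add_eq_zero_right h
  have lb : ∀ a b c, brB a (brB b c) = brB (brB a b) c + brB b (brB a c) := by
    intro a b c
    have h := jac a b c
    rw [sk (brB b c) a, sk (brB c a) b, sk c a, map_neg] at h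
    rw [← sub_eq_zero, ← neg_eq_zero, ← h]; abel
  have lz' : ∀ a b c, brB (mulB a b) c = mulB a (brB b c) + mulB b (brB a c) := by
    intro a b c
    rw [sk, lz, sk c a, sk c b, cm _ b]
    simp only [map_neg, LinearMap.neg_apply]; abel
  have pm' : ∀ x y z, mulA y (mulA x z) = mulA (mulA x y) z := by
    intro x y z
    rw [as, pm]
  refine ⟨⟨?_, ?_, ?_, ?_, ?_, ?_⟩, ?_, ?_, ?_, ?_⟩
  · intro s t u
    refine sub_eq_zero.1 (tri_zero (fun s t u => m s (m t u) - (m (m s t) u)) ?_ ?_ ?_ ?_ s t u)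
    · intros; simp only [map_add, map_sub, LinearMap.add_apply]; abel
    · intros; simp only [map_add, map_sub, LinearMap.add_apply]; abel
    · intros; simp only [map_add, map_sub, LinearMap.add_apply]; abel
    · intro x y z a b c
      simp only [hm, hbk, hBT, map_add, map_sub]
      rw [as, asB, sub_self]
  · intro s t u
    refine sub_eq_zero.1 (tri_zero (fun s t u => m (m s t) u - (m (m t s) u)) ?_ ?_ ?_ ?_ s t u)
    · intros; simp only [map_add, map_sub, LinearMap.add_apply]; abel
    · intros; simp only [map_add, map_sub, LinearMap.add_apply]; abel
    · intros; simp only [map_add, map_sub, LinearMap.add_apply]; abel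
    · intro x y z a b c
      simp only [hm, hbk, hBT, map_add, map_sub]
      rw [pm x y, cm a b, sub_self]
  · intro s t u
    refine sub_eq_zero.1 (tri_zero (fun s t u => bk s (bk t u) - (bk (bk s t) u + bk t (bk s u))) ?_ ?_ ?_ ?_ s t u)
    · intros; simp only [map_add, map_sub, LinearMap.add_apply]; abel
    · intros; simp only [map_add, map_sub, LinearMap.add_apply]; abel
    · intros; simp only [map_add, map_sub, LinearMap.add_apply]; abel
    · intro x y z a b c
      simp only [hm, hbk, hBT, map_add, map_sub]
      rw [lb a b c, pm' x y z, as x y z, TensorProduct.tmul_add, sub_self]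
  · intro s t u
    refine sub_eq_zero.1 (tri_zero (fun s t u => bk s (m t u) - (m (bk s t) u + m t (bk s u))) ?_ ?_ ?_ ?_ s t u)
    · intros; simp only [map_add, map_sub, LinearMap.add_apply]; abel
    · intros; simp only [map_add, map_sub, LinearMap.add_apply]; abel
    · intros; simp only [map_add, map_sub, LinearMap.add_apply]; abel
    · intro x y z a b c
      simp only [hm, hbk, hBT, map_add, map_sub]
      rw [lz a b c, pm' x y z, as x y z, TensorProduct.tmul_add, sub_self]
  · intro s t u
    refine sub_eq_zero.1 (tri_zero (fun s t u => bk (m s t) u - (m s (bk t u) + m t (bk s u))) ?_ ?_ ?_ ?_ s t u)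
    · intros; simp only [map_add, map_sub, LinearMap.add_apply]; abel
    · intros; simp only [map_add, map_sub, LinearMap.add_apply]; abel
    · intros; simp only [map_add, map_sub, LinearMap.add_apply]; abel
    · intro x y z a b c
      simp only [hm, hbk, hBT, map_add, map_sub]
      rw [lz' a b c, pm' x y z, as x y z, TensorProduct.tmul_add, sub_self]
  · intro s t u
    refine sub_eq_zero.1 (tri_zero (fun s t u => m (bk s t) u - (- m (bk t s) u)) ?_ ?_ ?_ ?_ s t u)
    · intros; simp only [map_add, map_sub, LinearMap.add_apply]; abel
    · intros; simp only [map_add, map_sub, LinearMap.add_apply]; abel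
    · intros; simp only [map_add, map_sub, LinearMap.add_apply]; abel
    · intro x y z a b c
      simp only [hm, hbk, hBT, map_add, map_sub]
      rw [pm y x z, sk b a]
      simp only [map_neg, LinearMap.neg_apply, TensorProduct.tmul_neg]; abel
  · intro s t
    induction s with
    | zero => simp
    | add s s' hs hs' => simp only [map_add, LinearMap.add_apply, hs, hs']; abel
    | tmul x a =>
      induction t with
      | zero => simp
      | add s s' hs hs' => simp only [map_add, LinearMap.add_apply, hs, hs']; abel
      | tmul y b => rw [hBT, hBT, hBAskew x y, hBBsymm a b, neg_mul]
  · intro s hs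
    have iA : Function.Injective BA :=
      (injective_iff_map_eq_zero BA).2 fun x hx => hBAnd x fun y => by rw [hx]; rfl
    have iB : Function.Injective BB :=
      (injective_iff_map_eq_zero BB).2 fun x hx => hBBnd x fun y => by rw [hx]; rfl
    have key : BT = (TensorProduct.dualDistrib F A B) ∘ₗ (TensorProduct.map BA BB) := by
      ext x a y b
      simp [hBT]
    have h0 : BT s = 0 := LinearMap.ext hs
    rw [key, LinearMap.comp_apply] at h0
    have h1 : TensorProduct.map BA BB s = 0 :=
      (TensorProduct.dualDistribEquiv F A B).injective (h0.trans (map_zero _).symm)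
    exact TensorProduct.map_injective_of_flat_flat BA BB iA iB (h1.trans (map_zero _).symm)
  · intro s t u
    refine sub_eq_zero.1 (tri_zero (fun s t u => BT (m s t) u - (BT s (m t u - m u t))) ?_ ?_ ?_ ?_ s t u)
    · intros; simp only [map_add, map_sub, LinearMap.add_apply]; abel
    · intros; simp only [map_add, map_sub, LinearMap.add_apply]; abel
    · intros; simp only [map_add, map_sub, LinearMap.add_apply]; abel
    · intro x y z a b c
      simp only [hm, hbk, hBT, map_add, map_sub]
      rw [hBAinv, hBBinv1, cm c b, map_sub]; ring
  · intro s t u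
    refine sub_eq_zero.1 (tri_zero (fun s t u => BT (bk s t) u - (BT s (bk t u + bk u t))) ?_ ?_ ?_ ?_ s t u)
    · intros; simp only [map_add, map_sub, LinearMap.add_apply]; abel
    · intros; simp only [map_add, map_sub, LinearMap.add_apply]; abel
    · intros; simp only [map_add, map_sub, LinearMap.add_apply]; abel
    · intro x y z a b c
      simp only [hm, hbk, hBT, map_add, map_sub]
      rw [hBAinv, hBBinv2, sk c b, map_sub, map_neg]; ring
end

section
/- Let B be a skew-symmetric invariant bilinear form on a dual pre-Poisson algebra (A, ∘, [·,·]) over a field F of characteristic 0. Then for all x, y, z ∈ A: B(x∘y, z) = B(y, x∘z) and B([x,y], z) = −B(y, [x,z]). -/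
theorem stmt13 {F A : Type*} [Field F] [CharZero F] [AddCommGroup A] [Module F A]
    (mul br : A →ₗ[F] A →ₗ[F] A) (h : IsDualPrePoisson F mul br)
    (B : A →ₗ[F] A →ₗ[F] F)
    (hskew : ∀ x y : A, B x y = - B y x)
    (hinv1 : ∀ x y z : A, B (mul x y) z = B x (mul y z - mul z y))
    (hinv2 : ∀ x y z : A, B (br x y) z = B x (br y z + br z y)) :
    (∀ x y z : A, B (mul x y) z = B y (mul x z)) ∧
    (∀ x y z : A, B (br x y) z = - B y (br x z)) := by
  constructor
  · intro x y z
    have h1 := hinv1 x y z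
    have h2 := hinv1 x z y
    simp only [map_sub] at h1 h2
    have h3 := hskew (mul x z) y
    linear_combination h1 + h2 - h3
  · intro x y z
    have h1 := hinv2 x y z
    have h2 := hinv2 x z y
    simp only [map_add] at h1 h2
    have h3 := hskew (br x z) y
    linear_combination h1 - h2 + h3
end

section
/- Let (A, ∘, [·,·]) be a finite-dimensional dual pre-Poisson algebra over a field F of characteristic 0. (1) If B is a nondegenerate skew-symmetric invariant bilinear form on A, then the linear map φ: A → A* defined by ⟨φ(x), y⟩ = B(x,y) is a linear isomorphism satisfying, for all x, y ∈ A: φ(x∘y) = −L∘*(x)φ(y), φ(y∘x) = (−L∘* + R∘*)(x)φ(y), φ([x,y]) = L*(x)φ(y), and φ([y,x]) = −(L* + R*)(x)φ(y), where ⟨L∘*(x)a*, z⟩ = −⟨a*, x∘z⟩, ⟨R∘*(x)a*, z⟩ = −⟨a*, z∘x⟩, ⟨L*(x)a*, z⟩ = −⟨a*, [x,z]⟩, ⟨R*(x)a*, z⟩ = −⟨a*, [z,x]⟩; that is, the regular representation (A; L∘, R∘, L, R) and the coregular representation (A*; −L∘*, −L∘* + R∘*, L*, −L* − R*) are equivalent.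 (2) Conversely, if there exists a linear isomorphism φ: A → A* satisfying the four equations above for all x,y ∈ A, then B(x,y) := ⟨φ(x), y⟩ is a nondegenerate invariant bilinear form on A. -/
/-- For a bilinear operation `m` on `A`, the dual of the right multiplication
operator: `⟨(rightStar m x) a*, z⟩ = −⟨a*, m z x⟩`. -/
def rightStar {F A : Type*} [Field F] [AddCommGroup A] [Module F A]
    (m : A →ₗ[F] A →ₗ[F] A) (x : A) :
    Module.Dual F A →ₗ[F] Module.Dual F A :=
  -((m.flip x).dualMap)

theorem stmt14 {F A : Type*} [Field F] [CharZero F] [AddCommGroup A] [Module F A]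
    [FiniteDimensional F A]
    (mul br : A →ₗ[F] A →ₗ[F] A) (h : IsDualPrePoisson F mul br) :
    (∀ B : A →ₗ[F] A →ₗ[F] F,
      (∀ x y : A, B x y = - B y x) →
      (∀ x : A, (∀ y : A, B x y = 0) → x = 0) →
      (∀ x y z : A, B (mul x y) z = B x (mul y z - mul z y)) →
      (∀ x y z : A, B (br x y) z = B x (br y z + br z y)) →
      (Function.Bijective (fun x : A => (B x : Module.Dual F A)) ∧
       (∀ x y : A, (B (mul x y) : Module.Dual F A) = -(leftStar mul x (B y))) ∧
       (∀ x y : A, (B (mul y x) : Module.Dual F A)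
          = (-(leftStar mul x) + rightStar mul x) (B y)) ∧
       (∀ x y : A, (B (br x y) : Module.Dual F A) = leftStar br x (B y)) ∧
       (∀ x y : A, (B (br y x) : Module.Dual F A)
          = -((leftStar br x + rightStar br x) (B y))))) ∧
    (∀ φ : A ≃ₗ[F] Module.Dual F A,
      ((∀ x y : A, φ (mul x y) = -(leftStar mul x (φ y))) ∧
       (∀ x y : A, φ (mul y x) = (-(leftStar mul x) + rightStar mul x) (φ y)) ∧
       (∀ x y : A, φ (br x y) = leftStar br x (φ y)) ∧
       (∀ x y : A, φ (br y x) = -((leftStar br x + rightStar br x) (φ y)))) →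
      ((∀ x : A, (∀ y : A, φ x y = 0) → x = 0) ∧
       (∀ x y z : A, φ (mul x y) z = φ x (mul y z - mul z y)) ∧
       (∀ x y z : A, φ (br x y) z = φ x (br y z + br z y)))) := by
  refine ⟨fun B hs hn h1 h2 => ⟨?_, ?_, ?_, ?_, ?_⟩, fun φ hφ => ?_⟩
  · have hinj : Function.Injective (B : A →ₗ[F] Module.Dual F A) := by
      rw [injective_iff_map_eq_zero]
      intro x hx
      exact hn x fun y => by rw [hx]; rfl
    exact ⟨hinj, (LinearMap.injective_iff_surjective_of_finrank_eq_finrank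
      (Subspace.dual_finrank_eq (K := F) (V := A)).symm).1 hinj⟩
  · intro x y
    ext z
    have e : -(leftStar mul x (B y)) z = B y (mul x z) := by
      simp [leftStar]
    refine Eq.trans ?_ e.symm
    rw [hs y, h1, h1, map_sub, map_sub]
    ring
  · intro x y
    ext z
    have e : (-(leftStar mul x) + rightStar mul x) (B y) z
        = B y (mul x z) - B y (mul z x) := by
      simp [leftStar, rightStar, sub_eq_add_neg]
    refine Eq.trans ?_ e.symm
    rw [h1, map_sub]
  · intro x y
    ext z
    have e : leftStar br x (B y) z = - B y (br x z) := by
      simp [leftStar]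
    refine Eq.trans ?_ e.symm
    rw [hs y, h2, h2, map_add, map_add]
    ring
  · intro x y
    ext z
    have e : (-((leftStar br x + rightStar br x) (B y))) z
        = B y (br x z) + B y (br z x) := by
      simp [leftStar, rightStar, add_comm]
    refine Eq.trans ?_ e.symm
    rw [h2, map_add]
  · obtain ⟨-, h2, -, h4⟩ := hφ
    refine ⟨fun x hx => ?_, fun x y z => ?_, fun x y z => ?_⟩
    · apply φ.injective
      rw [map_zero]
      exact LinearMap.ext hx
    · rw [h2]
      simp [leftStar, rightStar, sub_eq_add_neg]
    · rw [h4]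
      simp [leftStar, rightStar, add_comm]
end

section
/- Let (A, ▷, ◁, ≻, ≺) be a pre-dual pre-Poisson algebra over a field F of characteristic 0. Define bilinear operations x ∘ y := x▷y + x◁y and [x, y] := x≻y + x≺y. Then (A, ∘, [·,·]) is a dual pre-Poisson algebra (the sub-adjacent dual pre-Poisson algebra), and (A; L▷, R◁, L≻, R≺) is a representation of (A, ∘, [·,·]), where L▷(x)y = x▷y, R◁(x)y = y◁x, L≻(x)y = x≻y, R≺(x)y = y≺x. -/
/-- A pre-dual pre-Poisson algebra structure: `rt` is `▷`, `lt` is `◁`,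
`su` is `≻`, `pr` is `≺`. -/
def IsPreDualPrePoisson (F : Type*) {A : Type*} [Field F] [AddCommGroup A] [Module F A]
    (rt lt su pr : A →ₗ[F] A →ₗ[F] A) : Prop :=
  -- pre-permutative algebra
  (∀ x y z : A, lt x (lt y z + rt y z) = lt (lt x y) z) ∧
  (∀ x y z : A, lt (lt x y) z = lt (rt y x) z) ∧
  (∀ x y z : A, lt (rt y x) z = rt y (lt x z)) ∧
  (∀ x y z : A, rt x (rt y z) = rt (lt x y + rt x y) z) ∧
  (∀ x y z : A, rt (lt x y + rt x y) z = rt (lt y x + rt y x) z) ∧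
  -- Leibniz-dendriform algebra
  (∀ x y z : A, su (pr x y + su x y) z = su x (su y z) - su y (su x z)) ∧
  (∀ x y z : A, pr (su x y) z = - pr (pr y x) z) ∧
  (∀ x y z : A, pr x (pr y z + su y z) = pr (pr x y) z + su y (pr x z)) ∧
  -- compatibility conditions
  (∀ x y z : A, pr x (rt y z + lt y z) = lt (pr x y) z + rt y (pr x z)) ∧
  (∀ x y z : A, su x (lt y z) = lt (su x y) z + lt y (su x z + pr x z)) ∧
  (∀ x y z : A, su x (rt y z) = rt (su x y + pr x y) z + rt y (su x z)) ∧
  (∀ x y z : A, pr (lt x y) z = lt x (su y z + pr y z) + rt y (pr x z)) ∧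
  (∀ x y z : A, su (rt x y + lt x y) z = rt x (su y z) + rt y (su x z)) ∧
  (∀ x y z : A, pr (rt x y - lt y x) z = 0) ∧
  (∀ x y z : A, lt (su x y + pr y x) z = 0) ∧
  (∀ x y z : A, rt (su x y + pr x y + su y x + pr y x) z = 0)

theorem stmt15 {F A : Type*} [Field F] [CharZero F] [AddCommGroup A] [Module F A]
    (rt lt su pr : A →ₗ[F] A →ₗ[F] A)
    (h : IsPreDualPrePoisson F rt lt su pr) :
    IsDualPrePoisson F (rt + lt) (su + pr) ∧
    IsDppRep F (rt + lt) (su + pr)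
      (fun x => rt x) (fun x => lt.flip x) (fun x => su x) (fun x => pr.flip x) := by
  obtain ⟨h1, h2, h3, h4, h5, h6, h7, h8, h9, h10, h11, h12, h13, h14, h15, h16⟩ := h
  simp only [map_add, map_sub, LinearMap.add_apply, LinearMap.sub_apply] at *
  refine ⟨⟨?_, ?_, ?_, ?_, ?_, ?_⟩, ⟨?_, ?_, ?_, ?_, ?_⟩⟩
  · intro x y z; simp only [map_add, LinearMap.add_apply]; grind
  · intro x y z; simp only [map_add, LinearMap.add_apply]; grind
  · intro x y z; simp only [map_add, LinearMap.add_apply]; grind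
  · intro x y z; simp only [map_add, LinearMap.add_apply]; grind
  · intro x y z; simp only [map_add, LinearMap.add_apply]; grind
  · intro x y z; simp only [map_add, LinearMap.add_apply]; grind
  -- linearity of the four maps
  iterate 4 exact ⟨fun x y => by simp, fun c x => by simp⟩
  -- the representation identities, checked pointwise
  refine ⟨?_, ?_, ?_, ?_, ?_, ?_, ?_, ?_, ?_, ?_, ?_, ?_, ?_, ?_, ?_, ?_⟩
  all_goals
    intro x y
    ext z
    simp only [map_add, map_sub, LinearMap.add_apply, LinearMap.sub_apply, LinearMap.comp_apply,
      LinearMap.flip_apply, LinearMap.neg_apply, LinearMap.zero_apply]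
    grind
end

section
/- Let (A, ∘, [·,·]) be a dual pre-Poisson algebra over a field F of characteristic 0, let (V; l∘, r∘, l, r) be a representation of (A, ∘, [·,·]), and let T: V → A be an O-operator associated to this representation. Define bilinear operations on V by u ▷ v := l∘(T(u))v, u ◁ v := r∘(T(v))u, u ≻ v := l(T(u))v, u ≺ v := r(T(v))u. Then (V, ▷, ◁, ≻, ≺) is a pre-dual pre-Poisson algebra, and T is a homomorphism of dual pre-Poisson algebras from its sub-adjacent dual pre-Poisson algebra (V, ∘_V, [·,·]_V) (where u ∘_V v = u▷v + u◁v and [u,v]_V = u≻v + u≺v) to (A, ∘, [·,·]). -/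
theorem stmt16 {F A V : Type*} [Field F] [CharZero F] [AddCommGroup A] [Module F A]
    [AddCommGroup V] [Module F V]
    (mul br : A →ₗ[F] A →ₗ[F] A) (h : IsDualPrePoisson F mul br)
    (lc rc lb rb : A → (V →ₗ[F] V)) (hrep : IsDppRep F mul br lc rc lb rb)
    (T : V →ₗ[F] A)
    (hT1 : ∀ u v : V, mul (T u) (T v) = T (lc (T u) v + rc (T v) u))
    (hT2 : ∀ u v : V, br (T u) (T v) = T (lb (T u) v + rb (T v) u))
    (rt lt su pr : V →ₗ[F] V →ₗ[F] V)
    (hrt : ∀ u v : V, rt u v = lc (T u) v)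
    (hlt : ∀ u v : V, lt u v = rc (T v) u)
    (hsu : ∀ u v : V, su u v = lb (T u) v)
    (hpr : ∀ u v : V, pr u v = rb (T v) u) :
    IsPreDualPrePoisson F rt lt su pr ∧
    (∀ u v : V, T (rt u v + lt u v) = mul (T u) (T v)) ∧
    (∀ u v : V, T (su u v + pr u v) = br (T u) (T v)) := by
  obtain ⟨hlc, hrc, hlb, hrb, a1, a2, a3, a4, a5, a6, a7, a8, a9, a10, a11, a12, a13, a14, a15,
    a16⟩ := hrep
  have m : ∀ u v : V, T (lc (T u) v + rc (T v) u) = mul (T u) (T v) := fun u v => (hT1 u v).symm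
  have m' : ∀ u v : V, T (rc (T v) u + lc (T u) v) = mul (T u) (T v) := fun u v => by
    rw [add_comm, m]
  have b : ∀ u v : V, T (lb (T u) v + rb (T v) u) = br (T u) (T v) := fun u v => (hT2 u v).symm
  have b' : ∀ u v : V, T (rb (T v) u + lb (T u) v) = br (T u) (T v) := fun u v => by
    rw [add_comm, b]
  refine ⟨⟨?_, ?_, ?_, ?_, ?_, ?_, ?_, ?_, ?_, ?_, ?_, ?_, ?_, ?_, ?_, ?_⟩, ?_, ?_⟩
  all_goals first | intro x y z | intro x y
  all_goals simp only [hrt, hlt, hsu, hpr, m, m', b, b']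
  · exact (LinearMap.congr_fun (a1 (T z) (T y)) x).symm
  · exact LinearMap.congr_fun ((a1 (T z) (T y)).trans ((a2 _ _).trans (a3 _ _))) x
  · exact (LinearMap.congr_fun (a3 (T z) (T y)) x).symm
  · exact (LinearMap.congr_fun (a4 (T x) (T y)) z).symm
  · rw [a4, a4, a5]
  · exact LinearMap.congr_fun (a6 (T x) (T y)) z
  · have := LinearMap.congr_fun (a8 (T z) (T x)) y
    simp only [LinearMap.comp_apply, LinearMap.neg_apply] at this
    rw [this, neg_neg]
  · exact LinearMap.congr_fun (a7 (T y) (T z)) x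
  · exact LinearMap.congr_fun (a9 (T y) (T z)) x
  · exact LinearMap.congr_fun (a10 (T x) (T z)) y
  · exact LinearMap.congr_fun (a11 (T x) (T y)) z
  · exact LinearMap.congr_fun (a12 (T z) (T y)) x
  · exact LinearMap.congr_fun (a13 (T x) (T y)) z
  · exact LinearMap.congr_fun (a14 (T z) (T x)) y
  · exact LinearMap.congr_fun (a15 (T z) (T x)) y
  · rw [add_assoc (lb (T x) y + rb (T y) x), map_add, b, b, a16]
    rfl
end

section
/- Let (A, ∘, [·,·]) be a dual pre-Poisson algebra over a field F of characteristic 0 and let P: A → A be a Rota-Baxter operator, i.e. a linear map satisfying P(x)∘P(y) = P(P(x)∘y + x∘P(y)) and [P(x), P(y)] = P([P(x), y] + [x, P(y)]) for all x,y ∈ A. Define bilinear operations on A by x ▷ y := P(x)∘y, x ◁ y := x∘P(y), x ≻ y := [P(x), y], x ≺ y := [x, P(y)]. Then (A, ▷, ◁, ≻, ≺) is a pre-dual pre-Poisson algebra, and P is a homomorphism of dual pre-Poisson algebras from its sub-adjacent dual pre-Poisson algebra (with product x▷y + x◁y and bracket x≻y + x≺y) to (A, ∘, [·,·]). -/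
theorem stmt17 {F A : Type*} [Field F] [CharZero F] [AddCommGroup A] [Module F A]
    (mul br : A →ₗ[F] A →ₗ[F] A) (h : IsDualPrePoisson F mul br)
    (P : A →ₗ[F] A)
    (hP1 : ∀ x y : A, mul (P x) (P y) = P (mul (P x) y + mul x (P y)))
    (hP2 : ∀ x y : A, br (P x) (P y) = P (br (P x) y + br x (P y)))
    (rt lt su pr : A →ₗ[F] A →ₗ[F] A)
    (hrt : ∀ x y : A, rt x y = mul (P x) y)
    (hlt : ∀ x y : A, lt x y = mul x (P y))
    (hsu : ∀ x y : A, su x y = br (P x) y)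
    (hpr : ∀ x y : A, pr x y = br x (P y)) :
    IsPreDualPrePoisson F rt lt su pr ∧
    (∀ x y : A, P (rt x y + lt x y) = mul (P x) (P y)) ∧
    (∀ x y : A, P (su x y + pr x y) = br (P x) (P y)) := by
  obtain ⟨h1, h2, h3, h4, h5, h6⟩ := h
  have q1 : ∀ x y : A, P (mul (P x) y + mul x (P y)) = mul (P x) (P y) :=
    fun x y => (hP1 x y).symm
  have q2 : ∀ x y : A, P (mul x (P y) + mul (P x) y) = mul (P x) (P y) :=
    fun x y => by rw [add_comm, q1]
  have q3 : ∀ x y : A, P (br (P x) y + br x (P y)) = br (P x) (P y) :=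
    fun x y => (hP2 x y).symm
  have q4 : ∀ x y : A, P (br x (P y) + br (P x) y) = br (P x) (P y) :=
    fun x y => by rw [add_comm, q3]
  -- the left multiplication by a bracket is skew in the bracket
  have h7 : ∀ x y z : A, br (br x y) z = - br (br y x) z := by
    intro x y z
    have e1 := h3 x y z
    have e2 := h3 y x z
    rw [e2, ← add_assoc] at e1
    exact eq_neg_of_add_eq_zero_left (by simpa using e1.symm)
  refine ⟨⟨?_, ?_, ?_, ?_, ?_, ?_, ?_, ?_, ?_, ?_, ?_, ?_, ?_, ?_, ?_, ?_⟩, ?_, ?_⟩ <;>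
    simp only [hrt, hlt, hsu, hpr]
  · intro x y z
    rw [q2, h1]
  · intro x y z
    rw [h2]
  · intro x y z
    rw [h1]
  · intro x y z
    rw [q2, h1]
  · intro x y z
    rw [q2, q2, h2]
  · intro x y z
    rw [q4, h3 (P x) (P y) z]
    abel
  · intro x y z
    exact h7 _ _ _
  · intro x y z
    rw [q4, h3]
  · intro x y z
    rw [q1, h4]
  · intro x y z
    rw [q3, h4]
  · intro x y z
    rw [q3, h4]
  · intro x y z
    rw [q3, h5]
  · intro x y z
    rw [q1, h5]
  · intro x y z
    rw [map_sub, LinearMap.sub_apply, h5, h5, add_comm, sub_self]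
  · intro x y z
    rw [map_add, LinearMap.add_apply, h6, neg_add_cancel]
  · intro x y z
    rw [add_assoc, map_add, q3, q3, map_add, LinearMap.add_apply, h6, neg_add_cancel]
  · exact q1
  · exact q3
end

section
/- Let (A, ∘, [·,·]) be a dual pre-Poisson algebra over a field F of characteristic 0. There exists a compatible pre-dual pre-Poisson algebra structure on A (i.e. bilinear operations ▷, ◁, ≻, ≺ forming a pre-dual pre-Poisson algebra with x▷y + x◁y = x∘y and x≻y + x≺y = [x,y] for all x,y ∈ A) if and only if there exist a vector space V, a representation (V; l∘, r∘, l, r) of (A, ∘, [·,·]), and an invertible O-operator T: V → A associated to this representation. -/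
universe u v

set_option linter.unusedSimpArgs false in
theorem stmt18 {F : Type u} {A : Type v} [Field F] [CharZero F]
    [AddCommGroup A] [Module F A]
    (mul br : A →ₗ[F] A →ₗ[F] A) (h : IsDualPrePoisson F mul br) :
    (∃ rt lt su pr : A →ₗ[F] A →ₗ[F] A,
        IsPreDualPrePoisson F rt lt su pr ∧
        (∀ x y : A, rt x y + lt x y = mul x y) ∧
        (∀ x y : A, su x y + pr x y = br x y)) ↔
    (∃ (V : Type v) (_ : AddCommGroup V) (_ : Module F V)
        (lc rc lb rb : A → (V →ₗ[F] V)) (T : V →ₗ[F] A),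
        IsDppRep F mul br lc rc lb rb ∧
        (∀ u v : V, mul (T u) (T v) = T (lc (T u) v + rc (T v) u)) ∧
        (∀ u v : V, br (T u) (T v) = T (lb (T u) v + rb (T v) u)) ∧
        Function.Bijective T) := by
  constructor
  · rintro ⟨rt, lt, su, pr, ⟨h1, h2, h3, h4, h5, h6, h7, h8, h9, h10, h11, h12, h13, h14, h15, h16⟩,
      hm, hb⟩
    have hm' : ∀ x y, lt x y + rt x y = mul x y := fun x y => by rw [add_comm, hm]
    have hb' : ∀ x y, pr x y + su x y = br x y := fun x y => by rw [add_comm, hb]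
    have h16' : ∀ x y z, rt (br x y + br y x) z = 0 := fun x y z => by
      rw [← hb, ← hb, ← add_assoc, h16]
    simp only [hm, hm', hb, hb'] at h1 h4 h5 h6 h8 h9 h10 h11 h12 h13
    refine ⟨A, inferInstance, inferInstance, fun x => rt x, fun x => lt.flip x, fun x => su x,
      fun x => pr.flip x, LinearMap.id, ⟨LinearMap.isLinear _, LinearMap.isLinear _,
      LinearMap.isLinear _, LinearMap.isLinear _, ?_, ?_, ?_, ?_, ?_, ?_, ?_, ?_, ?_, ?_, ?_, ?_,
      ?_, ?_, ?_, ?_⟩, ?_, ?_, Function.bijective_id⟩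
    · intro x y; ext v; exact (h1 v y x).symm
    · intro x y; ext v; exact (h1 v y x).trans ((h2 v y x).trans (h3 v y x))
    · intro x y; ext v; exact (h3 v y x).symm
    · intro x y; ext v; exact (h4 x y v).symm
    · intro x y; ext v; exact (h4 x y v).trans ((h5 x y v).trans (h4 y x v).symm)
    · intro x y; ext v; exact h6 x y v
    · intro x y; ext v; exact h8 v x y
    · intro x y; ext v; exact (neg_eq_iff_eq_neg.mpr (h7 y v x)).symm
    · intro x y; ext v; exact h9 v x y
    · intro x y; ext v; exact h10 x v y
    · intro x y; ext v; exact h11 x y v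
    · intro x y; ext v; exact h12 v y x
    · intro x y; ext v; exact h13 x y v
    · intro x y; ext v; exact h14 y v x
    · intro x y; ext v; exact h15 y v x
    · intro x y; ext v; exact h16' x y v
    · intro x y; exact (hm x y).symm
    · intro x y; exact (hb x y).symm
  · rintro ⟨V, _, _, lc, rc, lb, rb, T, ⟨l1, l2, l3, l4, h1, h2, h3, h4, h5, h6, h7, h8, h9, h10,
      h11, h12, h13, h14, h15, h16⟩, hm, hb, hT⟩
    obtain ⟨e, rfl⟩ : ∃ e : V ≃ₗ[F] A, (e : V →ₗ[F] A) = T :=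
      ⟨LinearEquiv.ofBijective T hT, by ext; rfl⟩
    have mk : ∀ f : A → (V →ₗ[F] V), IsLinearMap F f →
        ∃ g : A →ₗ[F] A →ₗ[F] A, ∀ x y, g x y = e (f x (e.symm y)) := fun f hf =>
      ⟨LinearMap.mk₂ F (fun x y => e (f x (e.symm y)))
        (by intros; simp [hf.map_add]) (by intros; simp [hf.map_smul])
        (by intros; simp) (by intros; simp), fun x y => rfl⟩
    obtain ⟨rt, hrt⟩ := mk lc l1
    obtain ⟨lt', hlt'⟩ := mk rc l2
    obtain ⟨su, hsu⟩ := mk lb l3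
    obtain ⟨pr', hpr'⟩ := mk rb l4
    obtain ⟨lt, hlt⟩ : ∃ lt : A →ₗ[F] A →ₗ[F] A, ∀ x y, lt x y = e (rc y (e.symm x)) :=
      ⟨lt'.flip, fun x y => hlt' y x⟩
    obtain ⟨pr, hpr⟩ : ∃ pr : A →ₗ[F] A →ₗ[F] A, ∀ x y, pr x y = e (rb y (e.symm x)) :=
      ⟨pr'.flip, fun x y => hpr' y x⟩
    have km : ∀ x y : A, rt x y + lt x y = mul x y := fun x y => by
      have := hm (e.symm x) (e.symm y)
      simp only [LinearEquiv.coe_coe, LinearEquiv.apply_symm_apply] at this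
      rw [this, hrt, hlt, map_add]
    have kb : ∀ x y : A, su x y + pr x y = br x y := fun x y => by
      have := hb (e.symm x) (e.symm y)
      simp only [LinearEquiv.coe_coe, LinearEquiv.apply_symm_apply] at this
      rw [this, hsu, hpr, map_add]
    have km' : ∀ x y, lt x y + rt x y = mul x y := fun x y => by rw [add_comm, km]
    have kb' : ∀ x y, pr x y + su x y = br x y := fun x y => by rw [add_comm, kb]
    have key : ∀ {f g : V →ₗ[F] V}, f = g → ∀ z : A, e (f (e.symm z)) = e (g (e.symm z)) := by
      rintro f g rfl z; rfl
    refine ⟨rt, lt, su, pr, ⟨?_, ?_, ?_, ?_, ?_, ?_, ?_, ?_, ?_, ?_, ?_, ?_, ?_, ?_, ?_, ?_⟩, km, kb⟩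
    · intro x y z
      have := key (h1 z y) x
      try simp only [km, km', kb, kb']
      simp only [hrt, hlt, hsu, hpr, LinearMap.comp_apply, LinearMap.add_apply, LinearMap.sub_apply,
        LinearMap.neg_apply, LinearMap.zero_apply, map_add, map_sub, map_neg, map_zero,
        LinearEquiv.symm_apply_apply] at this ⊢
      exact this.symm
    · intro x y z
      have := key ((h1 z y).trans ((h2 z y).trans (h3 z y))) x
      try simp only [km, km', kb, kb']
      simp only [hrt, hlt, hsu, hpr, LinearMap.comp_apply, LinearMap.add_apply, LinearMap.sub_apply,
        LinearMap.neg_apply, LinearMap.zero_apply, map_add, map_sub, map_neg, map_zero,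
        LinearEquiv.symm_apply_apply] at this ⊢
      exact this
    · intro x y z
      have := key (h3 z y) x
      try simp only [km, km', kb, kb']
      simp only [hrt, hlt, hsu, hpr, LinearMap.comp_apply, LinearMap.add_apply, LinearMap.sub_apply,
        LinearMap.neg_apply, LinearMap.zero_apply, map_add, map_sub, map_neg, map_zero,
        LinearEquiv.symm_apply_apply] at this ⊢
      exact this.symm
    · intro x y z
      have := key (h4 x y) z
      try simp only [km, km', kb, kb']
      simp only [hrt, hlt, hsu, hpr, LinearMap.comp_apply, LinearMap.add_apply, LinearMap.sub_apply,
        LinearMap.neg_apply, LinearMap.zero_apply, map_add, map_sub, map_neg, map_zero,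
        LinearEquiv.symm_apply_apply] at this ⊢
      exact this.symm
    · intro x y z
      have := key ((h4 x y).trans ((h5 x y).trans (h4 y x).symm)) z
      try simp only [km, km', kb, kb']
      simp only [hrt, hlt, hsu, hpr, LinearMap.comp_apply, LinearMap.add_apply, LinearMap.sub_apply,
        LinearMap.neg_apply, LinearMap.zero_apply, map_add, map_sub, map_neg, map_zero,
        LinearEquiv.symm_apply_apply] at this ⊢
      exact this
    · intro x y z
      have := key (h6 x y) z
      try simp only [km, km', kb, kb']
      simp only [hrt, hlt, hsu, hpr, LinearMap.comp_apply, LinearMap.add_apply, LinearMap.sub_apply,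
        LinearMap.neg_apply, LinearMap.zero_apply, map_add, map_sub, map_neg, map_zero,
        LinearEquiv.symm_apply_apply] at this ⊢
      exact this
    · intro x y z
      have := key (h8 z x) y
      try simp only [km, km', kb, kb']
      simp only [hrt, hlt, hsu, hpr, LinearMap.comp_apply, LinearMap.add_apply, LinearMap.sub_apply,
        LinearMap.neg_apply, LinearMap.zero_apply, map_add, map_sub, map_neg, map_zero,
        LinearEquiv.symm_apply_apply] at this ⊢
      exact (neg_eq_iff_eq_neg.mpr this).symm
    · intro x y z
      have := key (h7 y z) x
      try simp only [km, km', kb, kb']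
      simp only [hrt, hlt, hsu, hpr, LinearMap.comp_apply, LinearMap.add_apply, LinearMap.sub_apply,
        LinearMap.neg_apply, LinearMap.zero_apply, map_add, map_sub, map_neg, map_zero,
        LinearEquiv.symm_apply_apply] at this ⊢
      exact this
    · intro x y z
      have := key (h9 y z) x
      try simp only [km, km', kb, kb']
      simp only [hrt, hlt, hsu, hpr, LinearMap.comp_apply, LinearMap.add_apply, LinearMap.sub_apply,
        LinearMap.neg_apply, LinearMap.zero_apply, map_add, map_sub, map_neg, map_zero,
        LinearEquiv.symm_apply_apply] at this ⊢
      exact this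
    · intro x y z
      have := key (h10 x z) y
      try simp only [km, km', kb, kb']
      simp only [hrt, hlt, hsu, hpr, LinearMap.comp_apply, LinearMap.add_apply, LinearMap.sub_apply,
        LinearMap.neg_apply, LinearMap.zero_apply, map_add, map_sub, map_neg, map_zero,
        LinearEquiv.symm_apply_apply] at this ⊢
      exact this
    · intro x y z
      have := key (h11 x y) z
      try simp only [km, km', kb, kb']
      simp only [hrt, hlt, hsu, hpr, LinearMap.comp_apply, LinearMap.add_apply, LinearMap.sub_apply,
        LinearMap.neg_apply, LinearMap.zero_apply, map_add, map_sub, map_neg, map_zero,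
        LinearEquiv.symm_apply_apply] at this ⊢
      exact this
    · intro x y z
      have := key (h12 z y) x
      try simp only [km, km', kb, kb']
      simp only [hrt, hlt, hsu, hpr, LinearMap.comp_apply, LinearMap.add_apply, LinearMap.sub_apply,
        LinearMap.neg_apply, LinearMap.zero_apply, map_add, map_sub, map_neg, map_zero,
        LinearEquiv.symm_apply_apply] at this ⊢
      exact this
    · intro x y z
      have := key (h13 x y) z
      try simp only [km, km', kb, kb']
      simp only [hrt, hlt, hsu, hpr, LinearMap.comp_apply, LinearMap.add_apply, LinearMap.sub_apply,
        LinearMap.neg_apply, LinearMap.zero_apply, map_add, map_sub, map_neg, map_zero,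
        LinearEquiv.symm_apply_apply] at this ⊢
      exact this
    · intro x y z
      have := key (h14 z x) y
      try simp only [km, km', kb, kb']
      simp only [hrt, hlt, hsu, hpr, LinearMap.comp_apply, LinearMap.add_apply, LinearMap.sub_apply,
        LinearMap.neg_apply, LinearMap.zero_apply, map_add, map_sub, map_neg, map_zero,
        LinearEquiv.symm_apply_apply] at this ⊢
      exact this
    · intro x y z
      have := key (h15 z x) y
      try simp only [km, km', kb, kb']
      simp only [hrt, hlt, hsu, hpr, LinearMap.comp_apply, LinearMap.add_apply, LinearMap.sub_apply,
        LinearMap.neg_apply, LinearMap.zero_apply, map_add, map_sub, map_neg, map_zero,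
        LinearEquiv.symm_apply_apply] at this ⊢
      exact this
    · intro x y z
      have := key (h16 x y) z
      rw [l1.map_add] at this
      rw [show su x y + pr x y + su y x + pr y x = br x y + br y x by rw [← kb, ← kb, ← add_assoc]]
      simp only [hrt, hlt, hsu, hpr, LinearMap.comp_apply, LinearMap.add_apply, LinearMap.sub_apply,
        LinearMap.neg_apply, LinearMap.zero_apply, map_add, map_sub, map_neg, map_zero,
        LinearEquiv.symm_apply_apply] at this ⊢
      exact this
end

section
/- Let (A, ∘, [·,·]) be a finite-dimensional dual pre-Poisson algebra over a field F of characteristic 0 and let r ∈ A ⊗ A be symmetric (τ(r) = r, where τ is the flip). Write r = Σᵢ aᵢ ⊗ bᵢ, define r̃: A* → A by ⟨r̃(u*), v*⟩ = ⟨r, u* ⊗ v*⟩, set x■y = x∘y − y∘x and x□y = [x,y] + [y,x], and define P(r) = Σ_{i,j} ( aᵢ ⊗ aⱼ ⊗ (bᵢ∘bⱼ) − aᵢ ⊗ (bᵢ∘aⱼ) ⊗ bⱼ + (aᵢ■aⱼ) ⊗ bⱼ ⊗ bᵢ ) and L(r) = Σ_{i,j} ( aᵢ ⊗ aⱼ ⊗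 [bᵢ,bⱼ] + aᵢ ⊗ [bᵢ,aⱼ] ⊗ bⱼ − (aᵢ□aⱼ) ⊗ bᵢ ⊗ bⱼ ) in A ⊗ A ⊗ A. Then r is a solution of the permutative-Leibniz Yang-Baxter equation (i.e. P(r) = 0 and L(r) = 0) if and only if for all a*, b* ∈ A*: r̃(a*) ∘ r̃(b*) = r̃( −L∘*(r̃(a*))b* − L■*(r̃(b*))a* ) and [r̃(a*), r̃(b*)] = r̃( L*(r̃(a*))b* − L□*(r̃(b*))a* ), where for x ∈ A the maps on A* are defined by ⟨L∘*(x)c*, z⟩ = −⟨c*, x∘z⟩, ⟨L■*(x)c*, z⟩ = −⟨c*, x■z⟩, ⟨L*(x)c*, z⟩ = −⟨c*, [x,z]⟩, ⟨L□*(x)c*, z⟩ = −⟨c*, x□z⟩; that is, if and only if r̃ is an O-operator on (A, ∘, [·,·]) associated to the coregular representation (A*; −L∘*, −L∘* + R∘*, L*, −L* − R*). -/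
open scoped TensorProduct

/-- Contraction of the first tensor leg with a functional. -/
noncomputable def contr {F A : Type*} (M : Type*) [Field F] [AddCommGroup A] [Module F A]
    [AddCommGroup M] [Module F M] (p : Module.Dual F A) : A ⊗[F] M →ₗ[F] M :=
  (TensorProduct.lid F M).toLinearMap ∘ₗ LinearMap.rTensor M p

lemma contr_tmul {F A M : Type*} [Field F] [AddCommGroup A] [Module F A]
    [AddCommGroup M] [Module F M] (p : Module.Dual F A) (x : A) (m : M) :
    contr M p (x ⊗ₜ[F] m) = p x • m := by
  simp [contr]

lemma contr_eq_zero_iff {F A M : Type*} [Field F] [AddCommGroup A] [Module F A]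
    [AddCommGroup M] [Module F M] (T : A ⊗[F] M) :
    T = 0 ↔ ∀ p : Module.Dual F A, contr M p T = 0 := by
  refine ⟨fun h p => by rw [h, map_zero], fun h => ?_⟩
  classical
  let B := Module.Basis.ofVectorSpace F A
  apply (TensorProduct.equivFinsuppOfBasisLeft (N := M) B).injective
  rw [map_zero]
  ext k
  have key : ∀ T : A ⊗[F] M,
      TensorProduct.equivFinsuppOfBasisLeft (N := M) B T k = contr M (B.coord k) T := by
    intro T
    induction T with
    | zero => simp
    | tmul x y => simp [contr_tmul]
    | add x y hx hy => simp [hx, hy]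
  rw [key, h]
  rfl

lemma contr2_eq_zero_iff {F A : Type*} [Field F] [AddCommGroup A] [Module F A]
    (T : A ⊗[F] (A ⊗[F] A)) :
    T = 0 ↔ ∀ p q : Module.Dual F A, contr A q (contr (A ⊗[F] A) p T) = 0 := by
  rw [contr_eq_zero_iff]
  exact forall_congr' fun p => contr_eq_zero_iff _

theorem stmt19 {F A ι : Type*} [Field F] [CharZero F] [AddCommGroup A] [Module F A]
    [FiniteDimensional F A] [Fintype ι]
    (mul br : A →ₗ[F] A →ₗ[F] A) (h : IsDualPrePoisson F mul br)
    (r : A ⊗[F] A) (hsym : TensorProduct.comm F A A r = r)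
    (a b : ι → A) (hr : r = ∑ i, a i ⊗ₜ[F] b i)
    (rTilde : Module.Dual F A → A)
    (hrT : ∀ p : Module.Dual F A, rTilde p = ∑ i, p (a i) • b i) :
    -- `P(r) = 0 ∧ L(r) = 0`
    ((∑ i, ∑ j,
        (a i ⊗ₜ[F] (a j ⊗ₜ[F] (mul (b i) (b j)))
          - a i ⊗ₜ[F] ((mul (b i) (a j)) ⊗ₜ[F] b j)
          + ((mul - mul.flip) (a i) (a j)) ⊗ₜ[F] (b j ⊗ₜ[F] b i)) = 0)
      ∧ (∑ i, ∑ j,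
        (a i ⊗ₜ[F] (a j ⊗ₜ[F] (br (b i) (b j)))
          + a i ⊗ₜ[F] ((br (b i) (a j)) ⊗ₜ[F] b j)
          - ((br + br.flip) (a i) (a j)) ⊗ₜ[F] (b i ⊗ₜ[F] b j)) = 0))
    ↔
    -- `r̃` is an O-operator associated to the coregular representation
    (∀ p q : Module.Dual F A,
      mul (rTilde p) (rTilde q)
          = rTilde (-(leftStar mul (rTilde p) q) - leftStar (mul - mul.flip) (rTilde q) p)
      ∧ br (rTilde p) (rTilde q)
          = rTilde (leftStar br (rTilde p) q - leftStar (br + br.flip) (rTilde q) p)) := by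
  have hs : ∀ q : Module.Dual F A, ∑ j, q (b j) • a j = rTilde q := by
    intro q
    have := congrArg (contr A q) hsym
    rw [hr] at this
    simpa [contr_tmul, hrT] using this
  rw [contr2_eq_zero_iff, contr2_eq_zero_iff, ← forall_and]
  refine forall_congr' fun p => ?_
  rw [← forall_and]
  refine forall_congr' fun q => ?_
  have e1 : ∀ m : A →ₗ[F] A →ₗ[F] A,
      ∑ i, ∑ j, p (a i) • q (a j) • m (b i) (b j) = m (rTilde p) (rTilde q) := by
    intro m
    simp only [hrT, map_sum, map_smul, LinearMap.sum_apply, LinearMap.smul_apply,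
      Finset.smul_sum]
    rw [Finset.sum_comm]
    exact Finset.sum_congr rfl fun _ _ => Finset.sum_congr rfl fun _ _ => smul_comm _ _ _
  have e2 : ∀ m : A →ₗ[F] A →ₗ[F] A,
      ∑ i, ∑ j, p (a i) • q (m (b i) (a j)) • b j = - rTilde (leftStar m (rTilde p) q) := by
    intro m
    rw [hrT (leftStar m (rTilde p) q), Finset.sum_comm, ← Finset.sum_neg_distrib]
    refine Finset.sum_congr rfl fun j _ => ?_
    simp [leftStar, hrT, Finset.sum_smul, mul_smul]
  have e3 : ∀ m : A →ₗ[F] A →ₗ[F] A,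
      ∑ i, ∑ j, p (m (a i) (a j)) • q (b i) • b j = - rTilde (leftStar m (rTilde q) p) := by
    intro m
    rw [hrT (leftStar m (rTilde q) p), Finset.sum_comm, ← Finset.sum_neg_distrib]
    refine Finset.sum_congr rfl fun j _ => ?_
    simp [leftStar, ← hs, Finset.sum_smul, mul_smul]
    exact Finset.sum_congr rfl fun _ _ => smul_comm _ _ _
  have e4 : ∑ i, ∑ j, p ((mul - mul.flip) (a i) (a j)) • q (b j) • b i
      = rTilde (leftStar (mul - mul.flip) (rTilde q) p) := by
    rw [Finset.sum_comm, ← neg_neg (rTilde _), ← e3, ← Finset.sum_neg_distrib]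
    refine Finset.sum_congr rfl fun i _ => ?_
    rw [← Finset.sum_neg_distrib]
    refine Finset.sum_congr rfl fun j _ => ?_
    rw [← neg_smul, ← map_neg]
    simp
  have radd : ∀ u v, rTilde (u - v) = rTilde u - rTilde v := by
    intro u v
    simp [hrT, sub_smul, Finset.sum_sub_distrib]
  have rneg : ∀ u, rTilde (-u) = - rTilde u := by
    intro u
    simp [hrT, Finset.sum_neg_distrib]
  refine and_congr ?_ ?_
  · simp only [map_sum, map_add, map_sub, contr_tmul, map_smul, Finset.sum_add_distrib,
      Finset.sum_sub_distrib]
    rw [e1, e2, e4, radd, rneg, ← sub_eq_zero (a := mul _ _)]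
    refine Eq.congr ?_ rfl
    abel
  · simp only [map_sum, map_add, map_sub, contr_tmul, map_smul, Finset.sum_add_distrib,
      Finset.sum_sub_distrib]
    rw [e1, e2, e3, radd, ← sub_eq_zero (a := br _ _)]
    refine Eq.congr ?_ rfl
    abel
end
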